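/- arXiv:1704.00882 — 2 statements merged into one kernel-verified Lean document; each statement's English description precedes it below -/
import Mathlib

section
/- For every negative integer m and every integer n ≥ 1, the number of partitions of n with rank at most m is at most the number of partitions of n with crank at most m, i.e., N(≤ m, n) ≤ M(≤ m, n). -/
open scoped BigOperators

namespace RankCrank

/-- The `i`-th largest part of a partition (1-indexed); `0` if `i` exceeds
the number of parts. -/
def part {n : ℕ} (l : n.Partition) (i : ℕ) : ℕ :=
  ((l.parts.sort (· ≤ ·)).reverse).getD (i - 1) 0

/-- The rank of a partition: largest part minus number of parts. -/
def rank {n : ℕ} (l : n.Partition) : ℤ :=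
  (part l 1 : ℤ) - l.parts.card

/-- The crank of a partition: the largest part if there are no parts equal to 1,
otherwise the number of parts larger than the number of 1's minus the number of 1's. -/
def crank {n : ℕ} (l : n.Partition) : ℤ :=
  if l.parts.count 1 = 0 then (part l 1 : ℤ)
  else ((l.parts.filter (fun x => l.parts.count 1 < x)).card : ℤ) - l.parts.count 1

/-- `N m n` is the number of partitions of `n` with rank `m`. -/
noncomputable def N (m : ℤ) (n : ℕ) : ℕ :=
  Nat.card {l : n.Partition // rank l = m}

/-- `M m n` is the number of partitions of `n` with crank `m` for `n ≠ 1`, with the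
usual convention for `n = 1`. -/
noncomputable def M (m : ℤ) (n : ℕ) : ℤ :=
  if n = 1 then (if m = 0 then -1 else if m = 1 ∨ m = -1 then 1 else 0)
  else (Nat.card {l : n.Partition // crank l = m} : ℤ)

/-- `Nle m n = N(≤ m, n) = ∑_{r ≤ m} N(r,n)`; since `N(r,n) = 0` for `r < -n`,
the sum may be taken over `-n ≤ r ≤ m`. -/
noncomputable def Nle (m : ℤ) (n : ℕ) : ℤ :=
  ∑ r ∈ Finset.Icc (-(n : ℤ)) m, (N r n : ℤ)

/-- `Mle m n = M(≤ m, n) = ∑_{r ≤ m} M(r,n)`; since `M(r,n) = 0` for `r < -n`,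
the sum may be taken over `-n ≤ r ≤ m`. -/
noncomputable def Mle (m : ℤ) (n : ℕ) : ℤ :=
  ∑ r ∈ Finset.Icc (-(n : ℤ)) m, M r n

/-- The number of partitions of `n`. -/
noncomputable def p (n : ℕ) : ℕ := Nat.card n.Partition

/-- `ospt n = ∑_{m ≥ 0} m M(m,n) - ∑_{m ≥ 0} m N(m,n)`; since ranks and cranks of
partitions of `n` are at most `n`, the sums may be taken over `0 ≤ m ≤ n`. -/
noncomputable def ospt (n : ℕ) : ℤ :=
  (∑ m ∈ Finset.Icc (0 : ℤ) (n : ℤ), m * M m n) -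
    (∑ m ∈ Finset.Icc (0 : ℤ) (n : ℤ), m * (N m n : ℤ))

/-- The rank-set of a partition `λ`:  `{j - λ_{j+1} : 0 ≤ j ≤ ℓ-1} ∪ {j : j ≥ ℓ}`
(note `part l (j+1) = 0` for `j ≥ ℓ`). -/
def rankSet {n : ℕ} (l : n.Partition) : Set ℤ :=
  {x | ∃ j : ℕ, x = (j : ℤ) - (part l (j + 1) : ℤ)}

/-- `q m n` is the number of partitions of `n` whose rank-set contains `m`. -/
noncomputable def q (m : ℤ) (n : ℕ) : ℕ :=
  Nat.card {l : n.Partition // m ∈ rankSet l}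

/-- `prank m n` is the number of partitions of `n` with rank at least `m`. -/
noncomputable def prank (m : ℤ) (n : ℕ) : ℕ :=
  Nat.card {l : n.Partition // m ≤ rank l}

/-- `jm m l` is the number of columns of the `m`-Durfee rectangle of `l`: the largest
`j ≥ 0` with `λ_{m+j} ≥ j`. -/
noncomputable def jm {n : ℕ} (m : ℕ) (l : n.Partition) : ℕ :=
  sSup {j : ℕ | j ≤ part l (m + j)}

/-- The total number of smallest parts in all partitions of `n`. -/
def spt (n : ℕ) : ℕ :=
  ∑ l : n.Partition, l.parts.count ((l.parts.sort (· ≤ ·)).headD 0)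

/-- A bijection `τ` on partitions of `n` nearly preserves the rank–crank
distribution if `crank λ - rank (τ λ)` is `0` when `crank λ = 0`, is `0` or `1`
when `crank λ > 0`, and is `0` or `-1` when `crank λ < 0`. -/
def NearlyPreserves {n : ℕ} (τ : n.Partition ≃ n.Partition) : Prop :=
  ∀ l : n.Partition,
    (crank l = 0 → crank l - rank (τ l) = 0) ∧
    (0 < crank l → crank l - rank (τ l) = 0 ∨ crank l - rank (τ l) = 1) ∧
    (crank l < 0 → crank l - rank (τ l) = 0 ∨ crank l - rank (τ l) = -1)

end RankCrank

namespace QSer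

open Finset PowerSeries

/-- Integral power series, with variable `X`. -/
abbrev Ser := PowerSeries ℤ

/-- All coefficients of the series are nonnegative. -/
def Nn (f : Ser) : Prop := ∀ n, 0 ≤ coeff n f

lemma Nn.add {f g : Ser} (hf : Nn f) (hg : Nn g) : Nn (f + g) := fun n => by
  rw [map_add]; exact add_nonneg (hf n) (hg n)

lemma Nn.mul {f g : Ser} (hf : Nn f) (hg : Nn g) : Nn (f * g) := fun n => by
  rw [coeff_mul]; exact sum_nonneg fun p _ => mul_nonneg (hf _) (hg _)

lemma Nn.zero : Nn 0 := fun n => by simp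

lemma Nn.X_pow (k : ℕ) : Nn (X ^ k) := fun n => by
  rw [coeff_X_pow]; split_ifs <;> simp

lemma Nn.X : Nn X := by simpa using Nn.X_pow 1

lemma Nn.one : Nn 1 := by simpa using Nn.X_pow 0

lemma Nn.sum {ι : Type*} {s : Finset ι} {f : ι → Ser} (h : ∀ i ∈ s, Nn (f i)) :
    Nn (∑ i ∈ s, f i) := fun n => by
  rw [map_sum]; exact sum_nonneg fun i hi => h i hi n

lemma Nn.prod {ι : Type*} {s : Finset ι} {f : ι → Ser} (h : ∀ i ∈ s, Nn (f i)) :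
    Nn (∏ i ∈ s, f i) := by
  classical
  induction s using Finset.induction_on with
  | empty => simpa using Nn.one
  | insert a s ha ih =>
    rw [prod_insert ha]
    exact (h a (mem_insert_self _ _)).mul (ih fun i hi => h i (mem_insert_of_mem hi))

lemma eq_zero_of_X_pow_dvd {f : Ser} (h : ∀ n, X ^ n ∣ f) : f = 0 := by
  ext n
  exact X_pow_dvd_iff.mp (h (n + 1)) n (Nat.lt_succ_self n)

/-- Two families satisfying the same contracting recursion agree. -/
lemma eq_of_rec {ι : Type*} (F G a : ι → Ser) (σ : ι → ι)
    (hF : ∀ i, F i = a i + X * F (σ i)) (hG : ∀ i, G i = a i + X * G (σ i)) (i : ι) :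
    F i = G i := by
  have key : ∀ n i, X ^ n ∣ F i - G i := by
    intro n
    induction n with
    | zero => intro i; simp
    | succ n ih =>
      intro i
      rw [hF, hG, add_sub_add_left_eq_sub, ← mul_sub, pow_succ']
      exact mul_dvd_mul_left _ (ih _)
  exact sub_eq_zero.mp (eq_zero_of_X_pow_dvd fun n => key n i)

/-- The series `∑ t, X ^ t * f t`. -/
noncomputable def S (f : ℕ → Ser) : Ser :=
  PowerSeries.mk fun n => ∑ t ∈ range (n + 1), coeff n (X ^ t * f t)

lemma coeff_S (f : ℕ → Ser) (n : ℕ) :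
    coeff n (S f) = ∑ t ∈ range (n + 1), coeff n (X ^ t * f t) := coeff_mk _ _

lemma S_succ (f : ℕ → Ser) : S f = f 0 + X * S (fun t => f (t + 1)) := by
  ext n
  rw [map_add, coeff_S, sum_range_succ']
  cases n with
  | zero => simp
  | succ n =>
    rw [coeff_succ_X_mul, coeff_S]
    simp only [pow_zero, one_mul]
    rw [add_comm]
    congr 1
    refine sum_congr rfl fun t _ => ?_
    rw [pow_succ', mul_assoc, coeff_succ_X_mul]

lemma S_add (f g : ℕ → Ser) : S (fun t => f t + g t) = S f + S g :=
  eq_of_rec (ι := (ℕ → Ser) × (ℕ → Ser)) (fun p => S (fun t => p.1 t + p.2 t))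
    (fun p => S p.1 + S p.2) (fun p => p.1 0 + p.2 0)
    (fun p => (fun t => p.1 (t + 1), fun t => p.2 (t + 1)))
    (fun p => S_succ _) (fun p => by rw [S_succ p.1, S_succ p.2]; ring) (f, g)

lemma S_mul (c : Ser) (f : ℕ → Ser) : S (fun t => c * f t) = c * S f :=
  eq_of_rec (fun f => S (fun t => c * f t)) (fun f => c * S f) (fun f => c * f 0)
    (fun f t => f (t + 1)) (fun _ => S_succ _) (fun f => by rw [S_succ f]; ring) f

lemma S_sub (f g : ℕ → Ser) : S (fun t => f t - g t) = S f - S g := by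
  have := S_add (fun t => f t - g t) g
  simp only [sub_add_cancel] at this
  exact eq_sub_of_add_eq this.symm

lemma Nn.S {f : ℕ → Ser} (h : ∀ t, Nn (f t)) : Nn (S f) := fun n => by
  rw [coeff_S]
  exact sum_nonneg fun t _ => (Nn.X_pow t).mul (h t) n

/-- Summation of a Cauchy-type double sum. -/
lemma S_antidiag (H : ℕ → ℕ → Ser) :
    S (fun c => ∑ i ∈ range (c + 1), H i (c - i)) = S (fun i => S (fun t => H i t)) := by
  refine eq_of_rec (fun H : ℕ → ℕ → Ser => S (fun c => ∑ i ∈ range (c + 1), H i (c - i)))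
    (fun H => S (fun i => S (fun t => H i t))) (fun H => S (fun t => H 0 t))
    (fun H i t => H (i + 1) t) (fun H => ?_) (fun H => S_succ _) H
  have h1 : S (fun c => ∑ i ∈ range (c + 1), H i (c - i)) =
      S (fun c => H 0 c + ∑ i ∈ range c, H (i + 1) (c - (i + 1))) := by
    congr 1; funext c
    rw [sum_range_succ', add_comm]; simp
  rw [h1, S_add, S_succ (fun c => ∑ i ∈ range c, H (i + 1) (c - (i + 1)))]
  simp

/-- The geometric series `1 / (1 - X ^ s)` for `s ≥ 1`. -/
noncomputable def geo (s : ℕ) : Ser := S (fun t => X ^ ((s - 1) * t))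

lemma one_sub_mul_geo {s : ℕ} (hs : 1 ≤ s) : (1 - X ^ s) * geo s = 1 := by
  obtain ⟨e, rfl⟩ : ∃ e, s = e + 1 := ⟨s - 1, by omega⟩
  have h := S_succ fun t => X ^ (e * t)
  simp only [mul_zero, pow_zero, mul_add, mul_one, pow_add, mul_comm _ (X ^ e), S_mul] at h
  rw [geo, Nat.add_sub_cancel]
  linear_combination h

lemma Nn.geo (s : ℕ) : Nn (geo s) := Nn.S fun _ => Nn.X_pow _

/-- The product of `1 / (1 - X ^ i)` over `i ∈ s`. -/
noncomputable def GP (s : Finset ℕ) : Ser := ∏ i ∈ s, geo i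

lemma Nn.GP (s : Finset ℕ) : Nn (GP s) := Nn.prod fun i _ => Nn.geo i

lemma one_sub_mul_GP {s : Finset ℕ} {i : ℕ} (hi : i ∈ s) (h1 : 1 ≤ i) :
    (1 - X ^ i) * GP s = GP (s.erase i) := by
  rw [GP, ← mul_prod_erase s _ hi, ← mul_assoc, one_sub_mul_geo h1, one_mul, GP]

lemma Nn.one_sub_mul_GP {s : Finset ℕ} {i : ℕ} (hi : i ∈ s) (h1 : 1 ≤ i) :
    Nn ((1 - PowerSeries.X ^ i) * QSer.GP s) := by
  rw [QSer.one_sub_mul_GP hi h1]; exact Nn.GP _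

lemma X_pow_ne_one {s : ℕ} (hs : 1 ≤ s) : (1 - X ^ s : Ser) ≠ 0 := fun h => by
  have := one_sub_mul_geo hs
  rw [h, zero_mul] at this
  exact zero_ne_one this

/-- The Gaussian binomial coefficient. -/
noncomputable def gb : ℕ → ℕ → Ser
  | _, 0 => 1
  | 0, _ + 1 => 0
  | n + 1, k + 1 => gb n k + X ^ (k + 1) * gb n (k + 1)

@[simp] lemma gb_zero (n : ℕ) : gb n 0 = 1 := by cases n <;> rfl

lemma gb_succ (n k : ℕ) : gb (n + 1) (k + 1) = gb n k + X ^ (k + 1) * gb n (k + 1) := rfl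

lemma gb_eq_zero : ∀ {n k : ℕ}, n < k → gb n k = 0
  | _, 0, h => absurd h (Nat.not_lt_zero _)
  | 0, _ + 1, _ => rfl
  | n + 1, k + 1, h => by
    rw [gb_succ, gb_eq_zero (Nat.lt_of_succ_lt_succ h),
      gb_eq_zero (Nat.lt_succ_of_lt (Nat.lt_of_succ_lt_succ h))]
    simp

@[simp] lemma gb_self (n : ℕ) : gb n n = 1 := by
  induction n with
  | zero => rfl
  | succ n ih => rw [gb_succ, ih, gb_eq_zero (Nat.lt_succ_self n)]; simp

lemma Nn.gb : ∀ n k : ℕ, Nn (gb n k)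
  | n, 0 => by rw [gb_zero]; exact Nn.one
  | 0, _ + 1 => Nn.zero
  | n + 1, k + 1 => (Nn.gb n k).add ((Nn.X_pow _).mul (Nn.gb n (k + 1)))

/-- The second Pascal recursion. -/
lemma gb_succ' (n k : ℕ) (h : k ≤ n) :
    gb (n + 1) (k + 1) = gb n (k + 1) + X ^ (n - k) * gb n k := by
  induction n generalizing k with
  | zero =>
    obtain rfl : k = 0 := by omega
    simp [gb_eq_zero]
  | succ n ih =>
    cases k with
    | zero =>
      have h1 := ih 0 (Nat.zero_le _)
      have h2 := gb_succ n 0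
      have h3 := gb_succ (n + 1) 0
      simp only [gb_zero, Nat.sub_zero, zero_add] at h1 h2 h3 ⊢
      linear_combination h3 + X ^ 1 * h1 - h2
    | succ k =>
      obtain ⟨u, rfl⟩ : ∃ u, n = k + u := ⟨n - k, by omega⟩
      have h1 := ih k (by omega)
      have h3 := gb_succ (k + u + 1) (k + 1)
      have h4 := gb_succ (k + u) k
      have h5 := gb_succ (k + u) (k + 1)
      rw [show k + u - k = u by omega] at h1
      rw [show k + u + 1 - (k + 1) = u by omega]
      have h2 : X ^ (k + 2) * gb (k + u + 1) (k + 2) =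
          X ^ (k + 2) * gb (k + u) (k + 2) + X ^ (k + 1 + u) * gb (k + u) (k + 1) := by
        cases u with
        | zero =>
          rw [gb_eq_zero (show k + 0 + 1 < k + 2 by omega),
            gb_eq_zero (show k + 0 < k + 2 by omega), gb_eq_zero (show k + 0 < k + 1 by omega)]
          ring
        | succ u =>
          have := ih (k + 1) (by omega)
          rw [show k + (u + 1) - (k + 1) = u by omega] at this
          rw [this]
          ring
      linear_combination h3 + h1 + h2 - h5 - X ^ u * h4

lemma gb_absorb (m k : ℕ) (h : k ≤ m) :
    (1 - X ^ (m - k)) * gb m k = (1 - X ^ (k + 1)) * gb m (k + 1) := by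
  linear_combination gb_succ' m k h - gb_succ m k

lemma gb_absorb' (n k : ℕ) :
    (1 - X ^ (k + 1)) * gb (n + 1) (k + 1) = (1 - X ^ (n + 1)) * gb n k := by
  rcases le_or_gt k n with h | h
  · have h1 := gb_absorb n k h
    obtain ⟨u, rfl⟩ : ∃ u, n = k + u := ⟨n - k, by omega⟩
    rw [show k + u - k = u by omega] at h1
    rw [gb_succ]
    linear_combination -X ^ (k + 1) * h1
  · rw [gb_eq_zero h, gb_eq_zero (Nat.succ_lt_succ h)]; simp

/-- The generating function of weakly decreasing sequences of `a` entries, each at most `t`. -/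
noncomputable def bx (a t : ℕ) : Ser := gb (a + t) a

@[simp] lemma bx_zero_left (t : ℕ) : bx 0 t = 1 := by simp [bx]
@[simp] lemma bx_zero_right (a : ℕ) : bx a 0 = 1 := by simp [bx]

lemma bx_succ (a t : ℕ) : bx (a + 1) (t + 1) = bx a (t + 1) + X ^ (a + 1) * bx (a + 1) t := by
  have := gb_succ (a + (t + 1)) a
  rw [bx, bx, bx, show a + 1 + (t + 1) = a + (t + 1) + 1 by ring, this,
    show a + (t + 1) = a + 1 + t by ring]

lemma bx_succ' (a t : ℕ) : bx (a + 1) (t + 1) = bx (a + 1) t + X ^ (t + 1) * bx a (t + 1) := by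
  have := gb_succ' (a + (t + 1)) a (by omega)
  rw [bx, bx, bx, show a + 1 + (t + 1) = a + (t + 1) + 1 by ring, this,
    show a + (t + 1) - a = t + 1 by omega, show a + (t + 1) = a + 1 + t by ring]

lemma bx_absorb (n t : ℕ) : (1 - X ^ (n + 1)) * bx (n + 1) t = (1 - X ^ (n + 1 + t)) * bx n t := by
  have := gb_absorb' (n + t) n
  rw [bx, bx, show n + 1 + t = n + t + 1 by ring, this]

lemma Nn.bx (a t : ℕ) : Nn (bx a t) := Nn.gb _ _

/-- Gaussian binomial coefficients with the lower index shifted by one. -/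
noncomputable def hb (n : ℕ) : ℕ → Ser
  | 0 => 0
  | i + 1 => gb n i

@[simp] lemma hb_zero (n : ℕ) : hb n 0 = 0 := rfl

lemma hb_succ (n i : ℕ) : hb n (i + 1) = gb n i := rfl

lemma Nn.hb (n : ℕ) : ∀ i, Nn (hb n i)
  | 0 => Nn.zero
  | i + 1 => Nn.gb n i

lemma hb_pascal (n i : ℕ) : hb (n + 1) (i + 1) = hb n i + X ^ i * hb n (i + 1) := by
  cases i with
  | zero => simp [hb_succ]
  | succ i => exact gb_succ n i

lemma hb_pascal' (i u : ℕ) :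
    hb (i + u) (i + 1) = hb (i + u - 1) (i + 1) + X ^ u * hb (i + u - 1) i := by
  cases i with
  | zero => simp [hb_succ]
  | succ i =>
    have := gb_succ' (i + u) i (by omega)
    rw [Nat.add_sub_cancel_left] at this
    rw [show i + 1 + u = i + u + 1 by ring]
    exact this

lemma Nn.gb_sub_one {n k : ℕ} (h : k ≤ n) : Nn (QSer.gb n k - 1) := by
  induction n generalizing k with
  | zero => obtain rfl : k = 0 := by omega
            simpa using Nn.zero
  | succ n ih =>
    cases k with
    | zero => simpa using Nn.zero
    | succ k =>
      rw [gb_succ, add_sub_right_comm]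
      exact (ih (by omega)).add ((Nn.X_pow _).mul (Nn.gb _ _))

/-- Strong `q`-log-concavity of the Gaussian binomial coefficients. -/
lemma Nn.hb_logConcave (N : ℕ) : ∀ k d j : ℕ, j ≤ 2 * d + 2 →
    Nn (QSer.hb N (k + 1) * QSer.hb N (k + d + 1) -
      PowerSeries.X ^ j * (QSer.hb N k * QSer.hb N (k + d + 2))) := by
  have trivial_case : ∀ N k d j : ℕ, N ≤ k + d →
      Nn (QSer.hb N (k + 1) * QSer.hb N (k + d + 1) -
        PowerSeries.X ^ j * (QSer.hb N k * QSer.hb N (k + d + 2))) := by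
    intro N k d j h
    rw [hb_succ N (k + d + 1), gb_eq_zero (show N < k + d + 1 by omega)]
    simpa using (Nn.hb _ _).mul (Nn.hb _ _)
  induction N with
  | zero => exact fun k d j _ => trivial_case 0 k d j (Nat.zero_le _)
  | succ N ih =>
    intro k d j hj
    rcases le_or_gt (N + 1) (k + d) with h | h
    · exact trivial_case _ k d j h
    cases k with
    | zero => simpa using (Nn.hb _ _).mul (Nn.hb _ _)
    | succ k =>
      obtain ⟨u, rfl⟩ : ∃ u, N = k + 1 + d + u := ⟨N - (k + 1 + d), by omega⟩
      set N := k + 1 + d + u with hN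
      have pA := hb_pascal N k
      have pB := hb_pascal N (k + 1)
      have pD := hb_pascal N (k + d + 1)
      have pE := hb_pascal N (k + d + 2)
      have qB := hb_pascal' (k + 1) (d + u + 1)
      have qA := hb_pascal' k (d + u + 2)
      have qD := hb_pascal' (k + d + 1) (u + 1)
      have qE := hb_pascal' (k + d + 2) u
      rw [show k + 1 + (d + u + 1) = N + 1 by omega, Nat.add_sub_cancel] at qB
      rw [show k + (d + u + 2) = N + 1 by omega, Nat.add_sub_cancel] at qA
      rw [show k + d + 1 + (u + 1) = N + 1 by omega, Nat.add_sub_cancel] at qD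
      rw [show k + d + 2 + u = N + 1 by omega, Nat.add_sub_cancel] at qE
      have CE := fun j hj => ih (k + 1) d j hj
      have BD := fun j hj => ih k d j hj
      have BE := fun j hj => ih k (d + 1) j hj
      have CD : ∀ j, j ≤ 2 * d → Nn (QSer.hb N (k + 2) * QSer.hb N (k + d + 1) -
          PowerSeries.X ^ j * (QSer.hb N (k + 1) * QSer.hb N (k + d + 2))) := by
        intro j hj
        cases d with
        | zero =>
          obtain rfl : j = 0 := by omega
          simp only [add_zero, pow_zero, one_mul, mul_comm, sub_self]
          exact Nn.zero
        | succ d =>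
          have := ih (k + 1) d j (by omega)
          rwa [show k + 1 + d + 1 = k + (d + 1) + 1 by ring,
            show k + 1 + d + 2 = k + (d + 1) + 2 by ring] at this
      simp only [show k + 1 + d = k + d + 1 by ring, show k + (d + 1) = k + d + 1 by ring,
        show k + 1 + 1 = k + 2 by ring, show k + d + 1 + 1 = k + d + 2 by ring,
        show k + d + 2 + 1 = k + d + 3 by ring] at *
      rcases Nat.lt_or_ge j 1 with hj0 | hj1
      · obtain rfl : j = 0 := by omega
        have key := (((CD 0 (by omega)).add ((Nn.X_pow (k + d + 1)).mul (CE 1 (by omega)))).add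
          ((Nn.X_pow (d + u + 1)).mul (BD 1 (by omega)))).add
          ((Nn.X_pow (d + u + 1 + (k + d + 1))).mul (BE 2 (by omega)))
        rw [qB, qA, pD, pE]
        convert key using 1
        ring
      · rcases Nat.lt_or_ge j 2 with hj2 | hj2
        · obtain rfl : j = 1 := by omega
          have key := (((BD 1 (by omega)).add
            ((Nn.X_pow (k + 1 + (k + d + 1))).mul (CE 1 (by omega)))).add
            ((Nn.X_pow (k + d + 1)).mul (BE 2 (by omega)))).add
            ((Nn.X_pow (k + 1)).mul (CD 0 (by omega)))
          rw [pB, pA, pD, pE]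
          convert key using 1
          ring
        · obtain ⟨j, rfl⟩ : ∃ i, j = i + 2 := ⟨j - 2, by omega⟩
          have key := (((BE (j + 2) (by omega)).add
            ((Nn.X_pow (u + 1)).mul (BD (j + 1) (by omega)))).add
            ((Nn.X_pow (k + 1)).mul (CE (j + 1) (by omega)))).add
            ((Nn.X_pow (k + 1 + (u + 1))).mul (CD j (by omega)))
          rw [pB, pA, qD, qE]
          convert key using 1
          ring

lemma gb_absorb_mul (m k : ℕ) :
    X ^ k * (1 - X ^ (k + 1)) * gb m (k + 1) = (X ^ k - X ^ m) * gb m k := by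
  rcases le_or_gt k m with h | h
  · have := gb_absorb m k h
    obtain ⟨u, rfl⟩ : ∃ u, m = k + u := ⟨m - k, by omega⟩
    rw [Nat.add_sub_cancel_left] at this
    linear_combination -X ^ k * this
  · rw [gb_eq_zero h, gb_eq_zero (Nat.lt_succ_of_lt h)]; simp

/-- The polynomial `∑ k, X ^ (k ^ 2 + c * k) * gb n k * gb m k`. -/
noncomputable def PP (c n m : ℕ) : Ser :=
  ∑ k ∈ range (n + 1), X ^ (k ^ 2 + c * k) * gb n k * gb m k

lemma PP_rec (c n m : ℕ) :
    (1 - X ^ (n + 1)) * PP c (n + 1) m =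
      (1 - X ^ (c + n + 1 + m)) * PP c n m - X ^ (n + 1) * (1 - X ^ c) * PP (c + 1) n m := by
  have tele : ∀ K, ∑ k ∈ range (K + 1), X ^ (k ^ 2 + c * k) * gb m k *
      ((1 - X ^ (n + 1)) * gb (n + 1) k - (1 - X ^ (c + n + 1 + m)) * gb n k +
        X ^ (n + 1 + k) * (1 - X ^ c) * gb n k) =
      - (X ^ (n + 1 + K ^ 2 + K + c * (K + 1)) * (1 - X ^ (K + 1)) * gb n K * gb m (K + 1)) := by
    intro K
    induction K with
    | zero =>
      have := gb_absorb_mul m 0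
      simp only [gb_zero, pow_zero] at this
      simp
      linear_combination X ^ (n + 1 + c) * this
    | succ K ih =>
      rw [sum_range_succ, ih, gb_succ]
      have h1 := gb_absorb_mul n K
      have h2 := gb_absorb_mul m (K + 1)
      linear_combination X ^ (n + 1 + (K + 1) ^ 2 + c * (K + 2)) * gb n (K + 1) * h2
        - X ^ (K ^ 2 + K + c * (K + 1) + 1) * gb m (K + 1) * h1
  have h := tele (n + 1)
  rw [gb_eq_zero (Nat.lt_succ_self n)] at h
  have e1 : ∀ c, PP c n m = ∑ k ∈ range (n + 1 + 1), X ^ (k ^ 2 + c * k) * gb n k * gb m k := by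
    intro c
    rw [sum_range_succ _ (n + 1), gb_eq_zero (Nat.lt_succ_self n), PP]; simp
  rw [e1 c, e1 (c + 1), PP, mul_sum, mul_sum, mul_sum, ← sum_sub_distrib, ← sub_eq_zero,
    ← sum_sub_distrib]
  rw [mul_zero, zero_mul, neg_zero] at h
  rw [← h]
  refine sum_congr rfl fun k _ => ?_
  ring

lemma GP_Icc_right {a b : ℕ} (h : a ≤ b + 1) :
    (1 - X ^ (b + 1)) * GP (Icc a (b + 1)) = GP (Icc a b) := by
  rw [one_sub_mul_GP (by simp [h]) (by omega)]
  congr 1; ext i; simp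

lemma GP_Icc_left {a b : ℕ} (h : a ≤ b) (ha : 1 ≤ a) :
    (1 - X ^ a) * GP (Icc a b) = GP (Icc (a + 1) b) := by
  rw [one_sub_mul_GP (by simp [h]) ha]
  congr 1; ext i; simp

/-- The series `∑ t, X ^ ((e + 1) * t) * bx n t * bx m t`. -/
noncomputable def FF (e n m : ℕ) : Ser := S fun t => X ^ (e * t) * (bx n t * bx m t)

lemma FF_comm (e n m : ℕ) : FF e n m = FF e m n := by
  simp only [FF, mul_comm]

lemma FF_rec (e n m : ℕ) :
    (1 - X ^ (n + 1)) * FF e (n + 1) m = FF e n m - X ^ (n + 1) * FF (e + 1) n m := by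
  rw [FF, FF, FF, ← S_mul, ← S_mul, ← S_sub]
  congr 1; funext t
  linear_combination X ^ (e * t) * bx m t * bx_absorb n t

lemma FF_zero (e m : ℕ) : FF e 0 m = GP (Icc (e + 1) (e + 1 + m)) := by
  induction m generalizing e with
  | zero =>
    simp [FF, GP, geo]
  | succ m ih =>
    apply mul_left_cancel₀ (X_pow_ne_one (show 1 ≤ m + 1 by omega))
    have h1 := GP_Icc_right (show e + 1 ≤ e + 1 + m + 1 by omega)
    have h2 := GP_Icc_left (show e + 1 ≤ e + 1 + m + 1 by omega) (by omega)
    rw [FF_comm, FF_rec, FF_comm, ih, FF_comm, ih, show e + 1 + (m + 1) = e + 1 + m + 1 by ring,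
      ← h1, show e + 1 + 1 + m = e + 1 + m + 1 by ring, ← h2]
    ring

/-- The Heine-type transformation expressing `FF` as a polynomial times a product. -/
lemma FF_eq (e n m : ℕ) : FF e n m = GP (Icc (e + 1) (e + 1 + n + m)) * PP (e + 1) n m := by
  induction n generalizing e with
  | zero => rw [FF_zero]; simp [PP]
  | succ n ih =>
    apply mul_left_cancel₀ (X_pow_ne_one (show 1 ≤ n + 1 by omega))
    have h1 := GP_Icc_right (show e + 1 ≤ e + 1 + n + m + 1 by omega)
    have h2 := GP_Icc_left (show e + 1 ≤ e + 1 + n + m + 1 by omega) (by omega)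
    rw [FF_rec, ih, ih, ← h1, show e + 1 + 1 + n + m = e + 1 + n + m + 1 by ring, ← h2,
      show e + 1 + (n + 1) + m = e + 1 + n + m + 1 by ring]
    linear_combination -GP (Icc (e + 1) (e + 1 + n + m + 1)) * PP_rec (e + 1) n m

/-- The auxiliary series whose nonnegativity drives the inequality. -/
noncomputable def II (ρ σ : ℕ) : Ser :=
  S (fun t => X ^ t * (bx ρ t * bx (σ + 1) t)) +
    X ^ (σ + 6) * S (fun t => X ^ t * (bx (σ + 2) t * bx ρ (t + 1))) -
    X ^ 3 * S (fun t => X ^ t * (bx (ρ + 2) t * bx σ (t + 1)))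

lemma II_diag (ν : ℕ) : II ν ν =
    (1 - X ^ 2) * FF 1 ν (ν + 1) - X * (1 - X) * FF 1 ν (ν + 2) + X * FF 2 ν (ν + 1) := by
  have h1 : X ^ (ν + 4) * S (fun t => X ^ t * (bx (ν + 2) t * bx ν (t + 1))) =
      FF 1 ν (ν + 2) - FF 1 ν (ν + 1) := by
    have : FF 1 ν (ν + 2) - FF 1 ν (ν + 1) =
        S fun t => X ^ t * (bx ν t * (bx (ν + 2) t - bx (ν + 1) t)) := by
      rw [FF, FF, ← S_sub]; congr 1; funext t; rw [one_mul]; ring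
    rw [this, S_succ fun t => X ^ t * (bx ν t * _), ← S_mul, ← S_mul]
    simp only [bx_zero_right, sub_self, mul_zero, zero_add]
    congr 1; funext t
    rw [bx_succ (ν + 1) t]; ring
  have h2 : X ^ 2 * S (fun t => X ^ t * (bx (ν + 2) t * bx ν (t + 1))) =
      FF 1 ν (ν + 2) - FF 2 ν (ν + 1) := by
    have : FF 1 ν (ν + 2) - FF 2 ν (ν + 1) =
        S fun t => X ^ t * (bx ν t * (bx (ν + 2) t - X ^ t * bx (ν + 1) t)) := by
      rw [FF, FF, ← S_sub]; congr 1; funext t; ring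
    rw [this, S_succ fun t => X ^ t * (bx ν t * _), ← S_mul, ← S_mul]
    simp only [bx_zero_right, pow_zero, one_mul, sub_self, mul_zero, zero_add]
    congr 1; funext t
    rw [bx_succ' (ν + 1) t]; ring
  have h3 : FF 1 ν (ν + 1) = S (fun t => X ^ t * (bx ν t * bx (ν + 1) t)) := by
    rw [FF]; simp only [one_mul]
  rw [II, ← h3]
  linear_combination X ^ 2 * h1 - X * h2

lemma II_tele (ν : ℕ) : ∑ k ∈ range (ν + 1), X ^ (k ^ 2 + 2 * k) *
    (gb ν k * ((1 + X) * X ^ (k + 1) * gb (ν + 1) k - X * gb (ν + 2) k +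
      (1 - X ^ 2) * X ^ k * hb ν k - X ^ (2 * k + 2) * gb ν k) +
      X ^ (2 * k + 4) * (hb ν k * gb ν (k + 1))) = 0 := by
  have tele : ∀ K, ∑ k ∈ range (K + 1), X ^ (k ^ 2 + 2 * k) *
      (gb ν k * ((1 + X) * X ^ (k + 1) * gb (ν + 1) k - X * gb (ν + 2) k +
        (1 - X ^ 2) * X ^ k * hb ν k - X ^ (2 * k + 2) * gb ν k) +
        X ^ (2 * k + 4) * (hb ν k * gb ν (k + 1))) =
      X ^ ((K + 2) ^ 2) * (gb ν (K + 1) * hb ν K) := by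
    intro K
    induction K with
    | zero => simp; ring
    | succ K ih =>
      rw [sum_range_succ, ih, gb_succ (ν + 1) K, gb_succ ν K]
      have h1 : gb (ν + 1) K = hb ν K + X ^ K * gb ν K := hb_pascal ν K
      rw [h1]
      simp only [hb_succ]
      ring
  rw [tele, gb_eq_zero (Nat.lt_succ_self ν)]; simp

/-- The summand in the expansion of `II ν ν`. -/
noncomputable def TT (ν k : ℕ) : Ser :=
  GP (Icc 3 (2 * ν + 3)) * (gb ν k * gb (ν + 1) k) -
    (1 - X) * GP (Icc 3 (2 * ν + 4)) * X ^ k * (gb ν k * hb ν k) +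
    (1 - X) * GP (Icc 2 (2 * ν + 4)) * X ^ (2 * k + 2) *
      (gb ν k * gb ν k - X ^ 2 * (hb ν k * gb ν (k + 1)))

lemma II_eq_sum (ν : ℕ) :
    II ν ν = ∑ k ∈ range (ν + 1), X ^ (k ^ 2 + 2 * k) * TT ν k := by
  have e1 := GP_Icc_right (show 2 ≤ 2 * ν + 3 + 1 by omega)
  have e2 := GP_Icc_left (show 2 ≤ 2 * ν + 4 by omega) (by omega)
  have e3 := GP_Icc_left (show 2 ≤ 2 * ν + 3 by omega) (by omega)
  rw [← e1] at e3
  rw [II_diag, FF_eq, FF_eq, FF_eq, show 1 + 1 + ν + (ν + 1) = 2 * ν + 3 by ring,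
    show 1 + 1 + ν + (ν + 2) = 2 * ν + 4 by ring, show 2 + 1 + ν + (ν + 1) = 2 * ν + 4 by ring]
  simp only [TT]
  simp only [Nat.reduceAdd] at e2 e3 ⊢
  rw [← e3, ← e2, ← e1, ← sub_eq_zero]
  have h := congrArg (fun s => (1 - X) * GP (Icc 2 (2 * ν + 4)) * s) (II_tele ν)
  simp only [mul_zero] at h
  rw [← h, PP, PP, PP]
  simp only [mul_sum, ← sum_sub_distrib, ← sum_add_distrib]
  refine sum_congr rfl fun k _ => ?_
  ring

lemma geo_eq {s : ℕ} (hs : 1 ≤ s) : geo s = 1 + X ^ s * geo s := by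
  linear_combination one_sub_mul_geo hs

lemma Nn.geo_sub_one {s : ℕ} (hs : 1 ≤ s) : Nn (QSer.geo s - 1) := by
  rw [geo_eq hs, add_sub_cancel_left]; exact (Nn.X_pow _).mul (Nn.geo _)

lemma GP_Icc_345 {b : ℕ} (hb : 5 ≤ b) :
    GP (Icc 3 b) = geo 3 * geo 4 * geo 5 * GP (Icc 6 b) := by
  have h : Icc 3 b = insert 3 (insert 4 (insert 5 (Icc 6 b))) := by
    ext i; simp only [mem_Icc, mem_insert]; omega
  rw [h, GP, prod_insert (by simp), prod_insert (by simp), prod_insert (by simp), GP]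
  ring

lemma GP_Icc_two {b : ℕ} (hb : 2 ≤ b) : GP (Icc 2 b) = geo 2 * GP (Icc 3 b) := by
  have h : Icc 2 b = insert 2 (Icc 3 b) := by
    ext i; simp only [mem_Icc, mem_insert]; omega
  rw [h, GP, prod_insert (by simp), GP]

lemma GP_Icc_last {a b : ℕ} (h : a ≤ b + 1) : GP (Icc a (b + 1)) = GP (Icc a b) * geo (b + 1) := by
  rw [GP, prod_Icc_succ_top h, GP]

lemma geo_sum_sub_nonneg {s : ℕ} (hs : 3 ≤ s) :
    Nn (geo 1 - X - X ^ 2 - geo s) := by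
  obtain ⟨e, rfl⟩ : ∃ e, s = e + 3 := ⟨s - 3, by omega⟩
  have h : geo 1 = (∑ i ∈ range (e + 3), X ^ i) * geo (e + 3) := by
    apply mul_left_cancel₀ (X_pow_ne_one le_rfl)
    rw [one_sub_mul_geo le_rfl, ← mul_assoc, pow_one, mul_neg_geom_sum,
      one_sub_mul_geo (by omega)]
  have h2 : geo 1 - X - X ^ 2 - geo (e + 3) = (X + X ^ 2) * (geo (e + 3) - 1) +
      (∑ i ∈ range e, X ^ (i + 3)) * geo (e + 3) := by
    rw [h, sum_range_succ', sum_range_succ', sum_range_succ']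
    ring
  rw [h2]
  exact ((Nn.X.add (Nn.X_pow 2)).mul (Nn.geo_sub_one (by omega))).add
    ((Nn.sum fun i _ => Nn.X_pow _).mul (Nn.geo _))

lemma geo345_sub_nonneg {s : ℕ} (hs : 3 ≤ s) :
    Nn (geo 3 * geo 4 * geo 5 - geo s) := by
  have h1 : geo 3 * (1 + X ^ 4 + X ^ 5) = geo 1 - X - X ^ 2 := by
    apply mul_left_cancel₀ (X_pow_ne_one (show 1 ≤ 3 by omega))
    have a := one_sub_mul_geo (show 1 ≤ 3 by omega)
    have b := one_sub_mul_geo (show 1 ≤ 1 by omega)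
    linear_combination (1 + X ^ 4 + X ^ 5) * a - (1 + X + X ^ 2) * b
  have h4 := geo_eq (show 1 ≤ 4 by omega)
  have h5 := geo_eq (show 1 ≤ 5 by omega)
  have h2 : geo 3 * geo 4 * geo 5 - geo s = (geo 1 - X - X ^ 2 - geo s) +
      geo 3 * (X ^ 8 * geo 4 + X ^ 10 * geo 5 + X ^ 9 * (geo 4 * geo 5)) := by
    rw [← h1]
    linear_combination geo 3 * (geo 5 + X ^ 4) * h4 + geo 3 * (1 + X ^ 5 + X ^ 4 * geo 4) * h5
  rw [h2]
  exact (geo_sum_sub_nonneg hs).add ((Nn.geo _).mul ((((Nn.X_pow _).mul (Nn.geo _)).add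
    ((Nn.X_pow _).mul (Nn.geo _))).add ((Nn.X_pow _).mul ((Nn.geo _).mul (Nn.geo _)))))

lemma Nn.of_eq {f g : Ser} (h : f = g) (hg : Nn g) : Nn f := h ▸ hg

lemma nn_GP_sub {ν : ℕ} (hν : 1 ≤ ν) {g : ℕ} (h3 : 3 ≤ g) (hg : g ≤ 2 * ν + 3) :
    Nn (GP (Icc 3 (2 * ν + 3)) - X ^ g * GP (Icc 6 (2 * ν + 4))) := by
  have h : GP (Icc 3 (2 * ν + 3)) - X ^ g * GP (Icc 6 (2 * ν + 4)) =
      (1 - X ^ g) * GP (Icc 3 (2 * ν + 3)) +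
        X ^ g * (GP (Icc 6 (2 * ν + 3)) * (geo 3 * geo 4 * geo 5 - geo (2 * ν + 3 + 1))) := by
    rw [GP_Icc_last (show 6 ≤ 2 * ν + 3 + 1 by omega), GP_Icc_345 (by omega)]; ring
  refine Nn.of_eq h ?_
  exact (Nn.one_sub_mul_GP (by simp; omega) (by omega)).add
    ((Nn.X_pow _).mul ((Nn.GP _).mul (geo345_sub_nonneg (by omega))))

lemma nn_GP_sub_mul (ν : ℕ) :
    Nn (GP (Icc 3 (2 * ν + 3)) - (1 - X) * GP (Icc 3 (2 * ν + 4))) := by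
  have h := GP_Icc_right (show 3 ≤ 2 * ν + 3 + 1 by omega)
  refine Nn.of_eq (g := X * ((1 - X ^ (2 * ν + 3)) * GP (Icc 3 (2 * ν + 4)))) ?_ ?_
  · rw [← h]; ring
  · exact Nn.X.mul (Nn.one_sub_mul_GP (by simp) (by omega))

lemma one_sub_mul_geo_two_three : (1 - X) * geo 2 * geo 3 = (1 - X + X ^ 2) * geo 6 := by
  have h2 := one_sub_mul_geo (show 1 ≤ 2 by omega)
  have h3 := one_sub_mul_geo (show 1 ≤ 3 by omega)
  have h6 := one_sub_mul_geo (show 1 ≤ 6 by omega)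
  apply mul_left_cancel₀ (X_pow_ne_one (show 1 ≤ 2 by omega))
  apply mul_left_cancel₀ (X_pow_ne_one (show 1 ≤ 3 by omega))
  linear_combination (1 - X) * (1 - X ^ 3) * geo 3 * h2 + (1 - X) * h3 - (1 - X) * h6

lemma nn_GP_two (ν : ℕ) (hν : 1 ≤ ν) :
    Nn ((1 - X) * GP (Icc 2 (2 * ν + 4)) + X * GP (Icc 6 (2 * ν + 4))) := by
  have h4 := one_sub_mul_geo (show 1 ≤ 4 by omega)
  have h5 := one_sub_mul_geo (show 1 ≤ 5 by omega)
  have h6 := one_sub_mul_geo (show 1 ≤ 6 by omega)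
  have e1 : geo 4 * geo 6 = (1 - X ^ 5) * (geo 4 * geo 5 * geo 6) := by
    linear_combination -geo 4 * geo 6 * h5
  have e2 : geo 6 = (1 - X ^ 4) * (1 - X ^ 5) * (geo 4 * geo 5 * geo 6) := by
    linear_combination -(1 - X ^ 5) * geo 5 * geo 6 * h4 - geo 6 * h5
  have e3 : geo 5 * geo 6 = (1 - X ^ 4) * (geo 4 * geo 5 * geo 6) := by
    linear_combination -geo 5 * geo 6 * h4
  have e4 : 1 = (1 - X ^ 4) * (1 - X ^ 5) * (1 - X ^ 6) * (geo 4 * geo 5 * geo 6) := by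
    linear_combination -h6 + (1 - X ^ 6) * e2
  have h : (1 - X) * GP (Icc 2 (2 * ν + 4)) + X * GP (Icc 6 (2 * ν + 4)) =
      GP (Icc 6 (2 * ν + 4)) * (geo 4 * geo 6 + X ^ 2 * geo 6 +
        X ^ 10 * (geo 4 * geo 5 * geo 6) + X ^ 12 * (geo 5 * geo 6)) := by
    rw [GP_Icc_two (by omega), GP_Icc_345 (by omega)]
    linear_combination GP (Icc 6 (2 * ν + 4)) * (geo 4 * geo 5 * one_sub_mul_geo_two_three
      + X * e4 - e1 - X ^ 2 * e2 - X ^ 12 * e3)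
  refine Nn.of_eq h ?_
  refine (Nn.GP _).mul ((((?_ : Nn _).add ?_).add ?_).add ?_)
  · exact (Nn.geo _).mul (Nn.geo _)
  · exact (Nn.X_pow _).mul (Nn.geo _)
  · exact (Nn.X_pow _).mul (((Nn.geo _).mul (Nn.geo _)).mul (Nn.geo _))
  · exact (Nn.X_pow _).mul ((Nn.geo _).mul (Nn.geo _))

lemma nn_TT_zero_sub (ν : ℕ) (hν : 1 ≤ ν) :
    Nn (TT ν 0 - (GP (Icc 3 (2 * ν + 3)) - X ^ 3 * GP (Icc 6 (2 * ν + 4)))) := by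
  refine Nn.of_eq ?_ ((Nn.X_pow 2).mul (nn_GP_two ν hν))
  simp [TT]
  ring

lemma nn_TT_zero (ν : ℕ) (hν : 1 ≤ ν) : Nn (TT ν 0) :=
  Nn.of_eq (sub_add_cancel _ _).symm
    ((nn_TT_zero_sub ν hν).add (nn_GP_sub hν le_rfl (by omega)))

lemma nn_gb_term {ν k : ℕ} (h : k < ν) :
    Nn (gb ν k * ((1 - X ^ (k + 1)) * GP (Icc 3 (2 * ν + 3))) + X ^ (k + 1) *
      ((GP (Icc 3 (2 * ν + 3)) - X ^ (k + 4) * GP (Icc 6 (2 * ν + 4))) * gb ν (k + 1))) := by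
  have hν : 1 ≤ ν := by omega
  rcases k with _ | _ | k
  · refine Nn.of_eq ?_ ((nn_GP_sub hν (show 3 ≤ 5 by omega) (by omega)).add
      (Nn.X.mul ((nn_GP_sub hν (show 3 ≤ 4 by omega) (by omega)).mul
        (Nn.gb_sub_one (show 1 ≤ ν by omega)))))
    simp; ring
  · have h0 := gb_absorb_mul ν 0
    simp only [pow_zero, zero_add, one_mul, gb_zero, mul_one, pow_one] at h0
    have h1 : (1 - X ^ 2) * gb ν 1 = (1 + X) * (1 - X ^ ν) := by
      linear_combination (1 + X) * h0
    have hrest := (Nn.X_pow 2).mul ((nn_GP_sub hν (show 3 ≤ 5 by omega) (by omega)).mul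
      (Nn.gb_sub_one (show 2 ≤ ν by omega)))
    simp only [zero_add, Nat.reduceAdd] at hrest ⊢
    rcases Nat.lt_or_ge ν 3 with h3 | h3
    · obtain rfl : ν = 2 := by omega
      refine Nn.of_eq ?_ (((Nn.one_sub_mul_GP (i := 3) (s := Icc 3 (2 * 2 + 3)) (by simp)
        (by omega)).add (Nn.X.mul (nn_GP_sub hν (show 3 ≤ 6 by omega) (by omega)))).add hrest)
      linear_combination GP (Icc 3 (2 * 2 + 3)) * h1
    · have hp : Nn ((1 - X ^ ν) * GP (Icc 3 (2 * ν + 3))) :=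
        Nn.one_sub_mul_GP (by simp; omega) (by omega)
      refine Nn.of_eq ?_ (((hp.add (Nn.X.mul hp)).add ((Nn.X_pow 2).mul
        (nn_GP_sub hν (show 3 ≤ 5 by omega) (by omega)))).add hrest)
      linear_combination GP (Icc 3 (2 * ν + 3)) * h1
  · exact ((Nn.gb _ _).mul (Nn.one_sub_mul_GP (by simp; omega) (by omega))).add
      ((Nn.X_pow _).mul ((nn_GP_sub hν (by omega) (by omega)).mul (Nn.gb _ _)))

lemma nn_TT_succ {ν k : ℕ} (h : k < ν) : Nn (TT ν (k + 1)) := by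
  have hν : 1 ≤ ν := by omega
  have hp : Nn (gb ν (k + 1) * gb ν (k + 1) - X ^ 2 * (gb ν k * gb ν (k + 2))) :=
    Nn.hb_logConcave ν (k + 1) 0 2 le_rfl
  have h1 := (Nn.gb ν (k + 1)).mul (nn_gb_term h)
  have h2 := ((Nn.X_pow (k + 1)).mul ((Nn.gb ν (k + 1)).mul (Nn.gb ν k))).mul (nn_GP_sub_mul ν)
  have h3 := ((Nn.X_pow (2 * k + 4)).mul hp).mul (nn_GP_two ν hν)
  have h4 := ((Nn.X_pow (2 * k + 7)).mul (Nn.GP (Icc 6 (2 * ν + 4)))).mul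
    ((Nn.gb ν k).mul (Nn.gb ν (k + 2)))
  refine Nn.of_eq ?_ (((h1.add h2).add h3).add h4)
  rw [TT, gb_succ ν k, hb_succ]
  ring

lemma nn_TT {ν k : ℕ} (hν : 1 ≤ ν) (h : k ≤ ν) : Nn (TT ν k) := by
  cases k with
  | zero => exact nn_TT_zero ν hν
  | succ k => exact nn_TT_succ h

lemma nn_II_diag {ν : ℕ} (hν : 1 ≤ ν) : Nn (II ν ν) := by
  rw [II_eq_sum]
  exact Nn.sum fun k hk => (Nn.X_pow _).mul (nn_TT hν (by simpa [Nat.lt_succ_iff] using hk))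

lemma II_zero_zero : II 0 0 = geo 3 + X ^ 2 * ((1 - X) * geo 2 * geo 3 * geo 4) := by
  rw [II_eq_sum]
  have h3 : GP {3} = geo 3 := by simp [GP]
  have h4 : GP (Icc 2 4) = geo 2 * geo 3 * geo 4 := by
    rw [GP_Icc_two (by omega), GP_Icc_last (by omega), Icc_self, h3]; ring
  simp [TT, h3, h4]
  ring

lemma geo_three : geo 3 = (1 + X ^ 3) * geo 6 := by
  have h3 := one_sub_mul_geo (show 1 ≤ 3 by omega)
  have h6 := one_sub_mul_geo (show 1 ≤ 6 by omega)
  apply mul_left_cancel₀ (X_pow_ne_one (show 1 ≤ 3 by omega))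
  linear_combination h3 - h6

lemma II_zero_zero' : II 0 0 = geo 2 + X ^ 6 * ((1 - X + X ^ 2) * (geo 4 * geo 6)) := by
  have h2 := one_sub_mul_geo (show 1 ≤ 2 by omega)
  have h3 := one_sub_mul_geo (show 1 ≤ 3 by omega)
  have h4 := one_sub_mul_geo (show 1 ≤ 4 by omega)
  rw [II_zero_zero]
  linear_combination (X ^ 2 * geo 4 - X ^ 2) * one_sub_mul_geo_two_three - geo 3 * h2
    + geo 2 * h3 + X ^ 2 * (1 - X + X ^ 2) * geo 6 * h4

lemma nn_mul_II_zero_zero : Nn (geo 3 * II 0 0) := by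
  have g2 := geo_eq (show 1 ≤ 2 by omega)
  have g3 := geo_eq (show 1 ≤ 3 by omega)
  have h3 := one_sub_mul_geo (show 1 ≤ 3 by omega)
  have h4 := one_sub_mul_geo (show 1 ≤ 4 by omega)
  have h36 := geo_three
  have h34 : (1 - X + X ^ 2) * (geo 3 * geo 4) + X =
      geo 3 + X ^ 2 * geo 4 + X ^ 8 * (geo 3 * geo 4) := by
    linear_combination -X * h3 - X * (1 - X ^ 3) * geo 3 * h4 + geo 3 * h4 + X ^ 2 * geo 4 * h3
  have h : geo 3 * II 0 0 = geo 3 + X ^ 2 * geo 3 + X ^ 4 + X ^ 10 * geo 6 +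
      X ^ 6 * (geo 2 * geo 3) +
      X ^ 6 * (geo 6 * (geo 3 + X ^ 2 * geo 4 + X ^ 8 * (geo 3 * geo 4))) := by
    rw [II_zero_zero', ← h34]
    linear_combination (geo 3 + X ^ 2 * geo 3 + X ^ 4 * geo 3) * g2 + X ^ 4 * g3 + X ^ 7 * h36
  rw [h]
  refine ((((Nn.add ?_ ?_).add ?_).add ?_).add ?_).add ?_
  · exact Nn.geo _
  · exact (Nn.X_pow _).mul (Nn.geo _)
  · exact Nn.X_pow _
  · exact (Nn.X_pow _).mul (Nn.geo _)
  · exact (Nn.X_pow _).mul ((Nn.geo _).mul (Nn.geo _))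
  · exact (Nn.X_pow _).mul ((Nn.geo _).mul (((Nn.geo _).add ((Nn.X_pow _).mul (Nn.geo _))).add
      ((Nn.X_pow _).mul ((Nn.geo _).mul (Nn.geo _)))))

lemma nn_II_zero_add_II_one : Nn (II 0 0 + X ^ 7 * II 1 1) := by
  have h0 := nn_TT_zero_sub 1 le_rfl
  have h1 := nn_TT_succ (show 0 < 1 by omega)
  have e6 : GP (Icc 6 (2 * 1 + 4)) = geo 6 := by simp [GP]
  have e3 : GP (Icc 3 (2 * 1 + 3)) = geo 3 * geo 4 * geo 5 := by
    rw [GP_Icc_345 (by omega)]; simp [GP]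
  rw [e6, e3] at h0
  have h36 := geo_three
  have g4 := geo_eq (show 1 ≤ 4 by omega)
  have g5 := geo_eq (show 1 ≤ 5 by omega)
  have h : II 0 0 + X ^ 7 * II 1 1 = geo 2 + (X ^ 6 + X ^ 8) * (geo 4 * geo 6) +
      X ^ 7 * ((TT 1 0 - (geo 3 * geo 4 * geo 5 - X ^ 3 * geo 6)) + X ^ 3 * TT 1 (0 + 1) +
        (X ^ 7 * (geo 4 * geo 6) + X ^ 5 * (geo 3 * geo 4 * geo 5))) := by
    rw [II_zero_zero', II_eq_sum, sum_range_succ, sum_range_succ, sum_range_zero]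
    linear_combination X ^ 7 * (geo 3 * geo 4) * g5 + X ^ 7 * geo 4 * h36 + X ^ 10 * geo 6 * g4
  rw [h]
  refine (Nn.add ?_ ?_).add ((Nn.X_pow _).mul ((h0.add ((Nn.X_pow _).mul h1)).add ?_))
  · exact Nn.geo _
  · exact ((Nn.X_pow _).add (Nn.X_pow _)).mul ((Nn.geo _).mul (Nn.geo _))
  · exact ((Nn.X_pow _).mul ((Nn.geo _).mul (Nn.geo _))).add
      ((Nn.X_pow _).mul (((Nn.geo _).mul (Nn.geo _)).mul (Nn.geo _)))

lemma nn_II_step (ρ σ : ℕ) : Nn ((1 - X ^ (ρ + 3)) * II (ρ + 1) σ - II ρ σ) := by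
  have h1 : S (fun t => X ^ t * (bx (ρ + 1) t * bx (σ + 1) t)) =
      S (fun t => X ^ t * (bx ρ t * bx (σ + 1) t)) +
        X ^ (ρ + 3) * S (fun t => X ^ t * (bx (ρ + 1) t * bx (σ + 1) (t + 1))) := by
    rw [S_succ fun t => X ^ t * (bx (ρ + 1) t * bx (σ + 1) t),
      S_succ fun t => X ^ t * (bx ρ t * bx (σ + 1) t)]
    have : (fun t => X ^ (t + 1) * (bx (ρ + 1) (t + 1) * bx (σ + 1) (t + 1))) = fun t =>
        X ^ (t + 1) * (bx ρ (t + 1) * bx (σ + 1) (t + 1)) +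
          X ^ (ρ + 2) * (X ^ t * (bx (ρ + 1) t * bx (σ + 1) (t + 1))) := by
      funext t; rw [bx_succ ρ t]; ring
    rw [this, S_add, S_mul]
    simp only [bx_zero_right]
    ring
  have h1' : S (fun t => X ^ t * (bx (ρ + 1) t * bx (σ + 1) (t + 1))) =
      S (fun t => X ^ t * (bx (ρ + 1) t * bx (σ + 1) t)) +
        X * S (fun t => X ^ (2 * t) * (bx (ρ + 1) t * bx σ (t + 1))) := by
    rw [← S_mul, ← S_add]
    congr 1; funext t
    rw [bx_succ' σ t]; ring
  have h2 : S (fun t => X ^ t * (bx (σ + 2) t * bx (ρ + 1) (t + 1))) =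
      S (fun t => X ^ t * (bx (σ + 2) t * bx ρ (t + 1))) +
        X ^ (ρ + 1) * S (fun t => X ^ t * (bx (σ + 2) t * bx (ρ + 1) t)) := by
    rw [← S_mul, ← S_add]
    congr 1; funext t
    rw [bx_succ ρ t]; ring
  have h2' : S (fun t => X ^ t * (bx (σ + 2) t * bx (ρ + 1) t)) =
      1 + X ^ 2 * (S (fun t => X ^ t * (bx (σ + 2) t * bx (ρ + 1) (t + 1))) +
        X * S (fun t => X ^ (2 * t) * (bx (σ + 1) (t + 1) * bx (ρ + 1) (t + 1)))) := by
    rw [S_succ fun t => X ^ t * (bx (σ + 2) t * bx (ρ + 1) t)]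
    have : (fun t => X ^ (t + 1) * (bx (σ + 2) (t + 1) * bx (ρ + 1) (t + 1))) = fun t =>
        X * (X ^ t * (bx (σ + 2) t * bx (ρ + 1) (t + 1))) +
          X ^ 2 * (X ^ (2 * t) * (bx (σ + 1) (t + 1) * bx (ρ + 1) (t + 1))) := by
      funext t; rw [bx_succ' (σ + 1) t]; ring
    rw [this, S_add, S_mul, S_mul]
    simp only [bx_zero_right]
    ring
  have h3 : (1 - X ^ (ρ + 3)) * S (fun t => X ^ t * (bx (ρ + 3) t * bx σ (t + 1))) =
      S (fun t => X ^ t * (bx (ρ + 2) t * bx σ (t + 1))) -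
        X ^ (ρ + 3) * S (fun t => X ^ (2 * t) * (bx (ρ + 2) t * bx σ (t + 1))) := by
    rw [← S_mul, ← S_mul, ← S_sub]
    congr 1; funext t
    linear_combination X ^ t * bx σ (t + 1) * bx_absorb (ρ + 2) t
  have n1 : Nn (S fun t => X ^ (2 * t) * (bx (ρ + 1) t * bx σ (t + 1))) :=
    Nn.S fun t => (Nn.X_pow _).mul ((Nn.bx _ _).mul (Nn.bx _ _))
  have n2 : Nn (S fun t => X ^ (2 * t) * (bx (σ + 1) (t + 1) * bx (ρ + 1) (t + 1))) :=
    Nn.S fun t => (Nn.X_pow _).mul ((Nn.bx _ _).mul (Nn.bx _ _))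
  have n3 : Nn (S fun t => X ^ (2 * t) * (bx (ρ + 2) t * bx σ (t + 1))) :=
    Nn.S fun t => (Nn.X_pow _).mul ((Nn.bx _ _).mul (Nn.bx _ _))
  refine Nn.of_eq ?_ ((((Nn.X_pow (ρ + 4)).mul n1).add ((Nn.X_pow (ρ + σ + 7)).mul
    (Nn.one.add ((Nn.X_pow 3).mul n2)))).add ((Nn.X_pow (ρ + 6)).mul n3))
  rw [II, II]
  linear_combination h1 + X ^ (ρ + 3) * h1' + X ^ (σ + 6) * h2 + X ^ (σ + ρ + 7) * h2'
    - X ^ 3 * h3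

lemma nn_II_succ {ρ σ : ℕ} (h : Nn (II ρ σ)) : Nn (II (ρ + 1) σ) := by
  refine Nn.of_eq ?_ ((Nn.geo (ρ + 3)).mul ((nn_II_step ρ σ).add h))
  linear_combination -II (ρ + 1) σ * one_sub_mul_geo (show 1 ≤ ρ + 3 by omega)

lemma nn_II_one_zero : Nn (II 1 0) := by
  refine Nn.of_eq ?_ (((Nn.geo 3).mul (nn_II_step 0 0)).add nn_mul_II_zero_zero)
  linear_combination -II 1 0 * one_sub_mul_geo (show 1 ≤ 3 by omega)

lemma nn_II {ρ σ : ℕ} (h : σ ≤ ρ) (h1 : 1 ≤ ρ) : Nn (II ρ σ) := by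
  rcases Nat.eq_zero_or_pos σ with rfl | hσ
  · induction ρ, h1 using Nat.le_induction with
    | base => exact nn_II_one_zero
    | succ ρ h1 ih => exact nn_II_succ (ih (Nat.zero_le _))
  · induction ρ, h using Nat.le_induction with
    | base => exact nn_II_diag hσ
    | succ ρ h ih => exact nn_II_succ (ih (by omega))

lemma gb_pascal' (n k : ℕ) : gb (n + 1) (k + 1) = gb n (k + 1) + X ^ (n - k) * gb n k := by
  rcases le_or_gt k n with h | h
  · exact gb_succ' n k h
  · rw [gb_eq_zero h, gb_eq_zero (Nat.lt_succ_of_lt h), gb_eq_zero (Nat.succ_lt_succ h)]; simp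

/-- The `q`-Vandermonde convolution. -/
lemma gb_vandermonde (m n k : ℕ) : gb (m + n) k =
    ∑ i ∈ range (k + 1), X ^ (i * (m - (k - i))) * (gb m (k - i) * gb n i) := by
  induction n generalizing k with
  | zero =>
    rw [sum_eq_single 0]
    · simp
    · intro i _ hi
      rw [gb_eq_zero (Nat.pos_of_ne_zero hi)]; simp
    · simp
  | succ n ih =>
    cases k with
    | zero => simp
    | succ k =>
      rw [← add_assoc, gb_pascal', ih (k + 1), ih k, sum_range_succ' _ (k + 1),
        sum_range_succ' _ (k + 1), mul_sum, add_right_comm, ← sum_add_distrib]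
      congr 1
      · refine sum_congr rfl fun i hi => ?_
        have hik : i ≤ k := by simpa [Nat.lt_succ_iff] using hi
        rw [gb_pascal' n i, Nat.add_sub_add_right]
        rcases le_or_gt (k - i) m with h | h
        · rcases le_or_gt i n with h' | h'
          · have e : (i + 1) * (m - (k - i)) + (n - i) = m + n - k + i * (m - (k - i)) := by
              rw [add_mul, one_mul]; omega
            have e' := congrArg (fun s => (X : Ser) ^ s) e
            simp only [pow_add] at e'
            linear_combination -gb m (k - i) * gb n i * e'
          · rw [gb_eq_zero h', gb_eq_zero (Nat.lt_succ_of_lt h')]; simp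
        · rw [gb_eq_zero h]; simp
      · simp

lemma bx_comm (a t : ℕ) : bx a t = bx t a := by
  induction a generalizing t with
  | zero => simp
  | succ a ih =>
    induction t with
    | zero => simp
    | succ t iht => rw [bx_succ, ih, iht, bx_succ' t a]

lemma bx_durfee (e c : ℕ) : bx (c + 1 + e) c =
    ∑ i ∈ range (c + 1), X ^ (i * (i + e)) * (bx (i + e) (c - i) * bx i (c - i + 1)) := by
  rw [bx_comm, bx, show c + (c + 1 + e) = e + c + (c + 1) by ring, gb_vandermonde]
  refine sum_congr rfl fun i hi => ?_
  have hic : i ≤ c := by simpa [Nat.lt_succ_iff] using hi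
  rw [bx_comm (i + e), bx, bx, show e + c - (c - i) = i + e by omega,
    show c - i + (i + e) = e + c by omega, show i + (c - i + 1) = c + 1 by omega]

/-- The product `∏ i ∈ [1, n], 1 / (1 - X ^ i)`. -/
noncomputable def P (n : ℕ) : Ser := GP (Icc 1 n)

@[simp] lemma P_zero : P 0 = 1 := by simp [P, GP]

lemma P_succ (n : ℕ) : (1 - X ^ (n + 1)) * P (n + 1) = P n := GP_Icc_right (by omega)

lemma X_pow_dvd_P_sub_bx (a t : ℕ) : X ^ (t + 1) ∣ P a - bx a t := by
  induction a with
  | zero => simp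
  | succ a ih =>
    have h : P (a + 1) - bx (a + 1) t =
        geo (a + 1) * ((P a - bx a t) + X ^ (t + 1) * (X ^ a * bx a t)) := by
      linear_combination geo (a + 1) * (P_succ a - bx_absorb a t) -
        (P (a + 1) - bx (a + 1) t) * one_sub_mul_geo (show 1 ≤ a + 1 by omega)
    rw [h]
    exact (dvd_add ih (dvd_mul_right _ _)).mul_left _

lemma S_tele (A f : ℕ → Ser) (L : Ser) (h : ∀ t, A (t + 1) - A t = X ^ t * f t)
    (hL : ∀ t, X ^ t ∣ L - A t) : S f = L - A 0 := by
  have key : ∀ s, S f - (L - A 0) = X ^ s * S (fun t => f (t + s)) - (L - A s) := by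
    intro s
    induction s with
    | zero => simp
    | succ s ih =>
      rw [ih, S_succ fun t => f (t + s)]
      simp only [zero_add, add_assoc, add_comm 1 s]
      linear_combination -h s
  refine sub_eq_zero.mp (eq_zero_of_X_pow_dvd fun s => ?_)
  rw [key s]
  exact dvd_sub (dvd_mul_right _ _) (hL s)

lemma bx_absorb_right (a t : ℕ) :
    (1 - X ^ (t + 1)) * bx a (t + 1) = (1 - X ^ (a + t + 1)) * bx a t := by
  linear_combination bx_succ' a t - bx_succ a t + bx_absorb a t

/-- The level-`i` difference of the crank and rank series. -/
noncomputable def dd (κ i : ℕ) : Ser :=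
  P (i + κ + 1) * P i - X * S fun t => bx i (t + 1) * bx (i + κ + 1) t

/-- The auxiliary series `∑ t, X ^ t * bx (i + κ + 1) t * bx i t`. -/
noncomputable def TS (κ i : ℕ) : Ser := S fun t => bx (i + κ + 1) t * bx i t

lemma dd_eq (κ i : ℕ) :
    dd κ i = S (fun t => bx (i + κ) t * bx i t) - X ^ (i + 1) * TS κ i := by
  have h := S_tele (fun t => bx (i + κ + 1) t * bx i t)
    (fun t => X * (bx i (t + 1) * bx (i + κ + 1) t) + X * (bx (i + κ) (t + 1) * bx i (t + 1)) -
      X ^ (i + 1) * (bx (i + κ + 1) t * bx i t)) (P (i + κ + 1) * P i) (fun t => by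
        linear_combination bx i (t + 1) * bx_succ' (i + κ) t +
          bx (i + κ + 1) t * bx_absorb_right i t) (fun t => by
        have h1 := X_pow_dvd_P_sub_bx (i + κ + 1) t
        have h2 := X_pow_dvd_P_sub_bx i t
        have : P (i + κ + 1) * P i - bx (i + κ + 1) t * bx i t =
          P i * (P (i + κ + 1) - bx (i + κ + 1) t) + bx (i + κ + 1) t * (P i - bx i t) := by ring
        rw [this]
        exact (pow_dvd_pow _ (Nat.le_succ t)).trans (dvd_add (h1.mul_left _) (h2.mul_left _)))
  rw [S_sub, S_add, S_mul, S_mul, S_mul] at h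
  rw [dd, TS, S_succ fun t => bx (i + κ) t * bx i t]
  simp only [bx_zero_right] at h ⊢
  linear_combination -h

lemma S_bx (n : ℕ) : S (fun t => bx n t) = P (n + 1) := by
  have := FF_zero 0 n
  simp only [FF, zero_mul, pow_zero, bx_zero_left, one_mul] at this
  rw [this, P]; congr 2; ring

lemma dd_zero (κ : ℕ) : dd κ 0 = GP (Icc 2 (κ + 1)) - X ^ (κ + 3) * TS κ 0 := by
  have h1 := GP_Icc_left (show 1 ≤ κ + 1 by omega) le_rfl
  rw [dd_eq, TS]
  simp only [bx_zero_left, mul_one, zero_add]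
  rw [S_bx, S_bx, ← P_succ (κ + 1), ← h1]
  change _ = (1 - X ^ 1) * P (κ + 1) - _
  rw [← P_succ (κ + 1)]
  ring

/-- The positive part of the level-`σ + 1` difference. -/
noncomputable def XS (κ σ : ℕ) : Ser :=
  X ^ (σ + 3) * S fun t => X ^ t * (bx (σ + 1) t * bx (σ + κ) (t + 1))

/-- The negative part of the level-`σ + 1` difference. -/
noncomputable def WS (κ σ : ℕ) : Ser :=
  X ^ (2 * σ + κ + 6) * S fun t => X ^ t * (bx (σ + κ + 2) t * bx σ (t + 1))

lemma dd_succ (κ σ : ℕ) : dd κ (σ + 1) =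
    TS κ σ - X ^ (2 * σ + κ + 5) * TS κ (σ + 1) + XS κ σ - WS κ σ := by
  have h1 : S (fun t => bx (σ + κ + 1) t * bx (σ + 1) t) =
      S (fun t => bx (σ + κ + 1) t * bx σ t) +
        X ^ (σ + 2) * S (fun t => bx (σ + κ + 1) (t + 1) * bx (σ + 1) t) := by
    rw [S_succ fun t => bx (σ + κ + 1) t * bx (σ + 1) t,
      S_succ fun t => bx (σ + κ + 1) t * bx σ t]
    have : (fun t => bx (σ + κ + 1) (t + 1) * bx (σ + 1) (t + 1)) = fun t =>
        bx (σ + κ + 1) (t + 1) * bx σ (t + 1) +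
          X ^ (σ + 1) * (bx (σ + κ + 1) (t + 1) * bx (σ + 1) t) := by
      funext t; rw [bx_succ σ t]; ring
    rw [this, S_add, S_mul]
    simp only [bx_zero_right]
    ring
  have h2 : S (fun t => bx (σ + κ + 1) (t + 1) * bx (σ + 1) t) =
      S (fun t => bx (σ + κ + 1) t * bx (σ + 1) t) +
        X * S (fun t => X ^ t * (bx (σ + 1) t * bx (σ + κ) (t + 1))) := by
    rw [← S_mul, ← S_add]
    congr 1; funext t
    rw [bx_succ' (σ + κ) t]; ring
  have h3 : S (fun t => bx (σ + κ + 2) t * bx (σ + 1) t) =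
      S (fun t => bx (σ + κ + 1) t * bx (σ + 1) t) +
        X ^ (σ + κ + 3) * S (fun t => bx (σ + κ + 2) t * bx (σ + 1) (t + 1)) := by
    rw [S_succ fun t => bx (σ + κ + 2) t * bx (σ + 1) t,
      S_succ fun t => bx (σ + κ + 1) t * bx (σ + 1) t]
    have : (fun t => bx (σ + κ + 2) (t + 1) * bx (σ + 1) (t + 1)) = fun t =>
        bx (σ + κ + 1) (t + 1) * bx (σ + 1) (t + 1) +
          X ^ (σ + κ + 2) * (bx (σ + κ + 2) t * bx (σ + 1) (t + 1)) := by
      funext t; rw [bx_succ (σ + κ + 1) t]; ring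
    rw [this, S_add, S_mul]
    simp only [bx_zero_right]
    ring
  have h4 : S (fun t => bx (σ + κ + 2) t * bx (σ + 1) (t + 1)) =
      S (fun t => bx (σ + κ + 2) t * bx (σ + 1) t) +
        X * S (fun t => X ^ t * (bx (σ + κ + 2) t * bx σ (t + 1))) := by
    rw [← S_mul, ← S_add]
    congr 1; funext t
    rw [bx_succ' σ t]; ring
  rw [dd_eq, TS, TS, XS, WS, show σ + 1 + κ + 1 = σ + κ + 2 by ring,
    show σ + 1 + κ = σ + κ + 1 by ring]
  linear_combination h1 + X ^ (σ + 2) * h2 - X ^ (σ + 2) * h3 - X ^ (2 * σ + κ + 5) * h4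

/-- The exponent attached to level `i`. -/
def lev (κ i : ℕ) : ℕ := i ^ 2 + i * κ + i + κ + 1

lemma S_dd (κ : ℕ) : S (fun i => X ^ lev κ i * dd κ i) =
    X ^ lev κ 0 * GP (Icc 2 (κ + 1)) +
      X * S (fun σ => X ^ lev κ (σ + 1) * (XS κ σ - WS κ σ)) := by
  have h1 : (fun σ => X ^ lev κ (σ + 1) * dd κ (σ + 1)) = fun σ =>
      X ^ lev κ (σ + 1) * (XS κ σ - WS κ σ) +
        (X ^ lev κ (σ + 1) * TS κ σ - X * (X ^ lev κ (σ + 1 + 1) * TS κ (σ + 1))) := by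
    funext σ
    rw [dd_succ, lev, lev]; ring
  rw [S_succ, h1, S_add, S_sub, S_mul, S_succ fun σ => X ^ lev κ (σ + 1) * TS κ σ, dd_zero]
  simp only [lev]
  ring

/-- The part of `XS κ σ` left after one application of Pascal's rule. -/
noncomputable def XR (κ σ : ℕ) : Ser :=
  if σ + κ = 0 then 0
  else X ^ (σ + 3) * S fun t => X ^ t * (bx (σ + 1) t * bx (σ + κ - 1) (t + 1))

lemma nn_XR (κ σ : ℕ) : Nn (XR κ σ) := by
  rw [XR]
  split_ifs
  · exact Nn.zero
  · exact (Nn.X_pow _).mul (Nn.S fun t => (Nn.X_pow t).mul ((Nn.bx _ _).mul (Nn.bx _ _)))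

lemma XS_eq (κ σ : ℕ) : XS κ σ = XR κ σ +
    X ^ (2 * σ + κ + 3) * S fun t => X ^ t * (bx (σ + κ) t * bx (σ + 1) t) := by
  rw [XS, XR]
  split_ifs with h
  · obtain ⟨rfl, rfl⟩ : σ = 0 ∧ κ = 0 := by omega
    simp
  · obtain ⟨ρ, hρ⟩ : ∃ ρ, σ + κ = ρ + 1 := ⟨σ + κ - 1, by omega⟩
    have e : 2 * σ + κ + 3 = σ + 3 + (ρ + 1) := by omega
    rw [hρ, Nat.add_sub_cancel, e, pow_add _ (σ + 3), mul_assoc, ← mul_add, ← S_mul (X ^ (ρ + 1)),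
      ← S_add]
    congr 2
    funext t
    rw [bx_succ ρ t]; ring

lemma XS_sub_WS (κ σ : ℕ) : XS κ σ - WS κ σ + X ^ (2 * σ + κ + 4) * (X * XR κ (σ + 1)) =
    XR κ σ + X ^ (2 * σ + κ + 3) * II (σ + κ) σ := by
  have h : XR κ (σ + 1) =
      X ^ (σ + 1 + 3) * S fun t => X ^ t * (bx (σ + 2) t * bx (σ + κ) (t + 1)) := by
    rw [XR, if_neg (by omega), show σ + 1 + κ - 1 = σ + κ by omega]
  rw [XS_eq, WS, II, h]
  ring

/-- Combining consecutive levels turns the differences into the series `II`. -/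
lemma S_dd_eq_II (κ : ℕ) : S (fun i => X ^ lev κ i * dd κ i) =
    X ^ lev κ 0 * GP (Icc 2 (κ + 1)) + X * (X ^ lev κ 1 * XR κ 0) +
      X * S fun σ => X ^ (lev κ (σ + 1) + (2 * σ + κ + 3)) * II (σ + κ) σ := by
  have h : (fun σ => X ^ lev κ (σ + 1) * (XS κ σ - WS κ σ)) = fun σ =>
      (X ^ lev κ (σ + 1) * XR κ σ - X * (X ^ lev κ (σ + 1 + 1) * XR κ (σ + 1))) +
        X ^ (lev κ (σ + 1) + (2 * σ + κ + 3)) * II (σ + κ) σ := by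
    funext σ
    have e : lev κ (σ + 1 + 1) = lev κ (σ + 1) + (2 * σ + κ + 4) := by
      simp only [lev]; ring
    rw [e, pow_add, pow_add]
    linear_combination X ^ lev κ (σ + 1) * XS_sub_WS κ σ
  rw [S_dd, h, S_add, S_sub, S_mul, S_succ fun σ => X ^ lev κ (σ + 1) * XR κ σ]
  simp only [zero_add]
  ring

lemma nn_S_dd (κ : ℕ) : Nn (S fun i => X ^ lev κ i * dd κ i) := by
  rw [S_dd_eq_II]
  refine (((Nn.X_pow _).mul (Nn.GP _)).add
    (Nn.X.mul ((Nn.X_pow _).mul (nn_XR _ _)))).add (Nn.X.mul ?_)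
  rcases Nat.eq_zero_or_pos κ with rfl | hκ
  · have h : ∀ f : ℕ → Ser, S f = f 0 + X * f 1 + X ^ 2 * S fun t => f (t + 2) := fun f => by
      rw [S_succ f, S_succ fun t => f (t + 1)]; ring
    rw [h]
    refine Nn.add (Nn.of_eq (g := X ^ 6 * (II 0 0 + X ^ 7 * II 1 1)) ?_
      ((Nn.X_pow _).mul nn_II_zero_add_II_one)) ((Nn.X_pow _).mul (Nn.S fun t =>
        (Nn.X_pow _).mul (nn_II (by omega) (by omega))))
    simp only [lev]
    ring
  · exact Nn.S fun t => (Nn.X_pow _).mul (nn_II (by omega) (by omega))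

/-- The generating function of partitions of rank at most `-(κ + 1)`. -/
noncomputable def rankSer (κ : ℕ) : Ser :=
  X ^ (κ + 2) * S fun c => bx (c + 1 + (κ + 1)) c

lemma rankSer_eq (κ : ℕ) : rankSer κ =
    S fun i => X ^ lev κ i * (X * S fun t => bx i (t + 1) * bx (i + κ + 1) t) := by
  have h := S_antidiag fun i t =>
    X ^ (i * (i + (κ + 1))) * (bx (i + (κ + 1)) t * bx i (t + 1))
  rw [rankSer]
  simp only [bx_durfee]
  rw [h, ← S_mul]
  congr 1
  funext i
  rw [S_mul, show (fun t => bx i (t + 1) * bx (i + κ + 1) t) =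
    fun t => bx (i + (κ + 1)) t * bx i (t + 1) from funext fun t => mul_comm _ _, lev]
  ring

/-- The generating function of partitions of crank at most `-(κ + 1)`. -/
noncomputable def crankSer (κ : ℕ) : Ser :=
  X ^ (κ + 1) * S fun v => GP (Icc 2 (κ + 1 + v)) *
    ∑ d ∈ range (v + 1), X ^ ((κ + 1 + v + 1) * d) * P d

lemma sum_P_succ (u e : ℕ) : ∑ d ∈ range (e + 1), X ^ ((u + 1) * d) * P d =
    (1 - X ^ u) * ∑ d ∈ range e, X ^ (u * d) * P d + X ^ (u * e) * P e := by
  induction e with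
  | zero => simp
  | succ e ih =>
    rw [sum_range_succ, ih, sum_range_succ _ e]
    linear_combination -X ^ (u * (e + 1)) * P_succ e

lemma P_mul_sum (κ v : ℕ) :
    P (κ + 1 + v) * ∑ d ∈ range (v + 1), X ^ ((κ + 1 + v + 1) * d) * P d =
      ∑ D ∈ range (v + 1), X ^ (D * (D + κ + 1)) * (P (D + κ + 1) * P D) := by
  induction v with
  | zero => simp
  | succ v ih =>
    rw [sum_range_succ (fun D => X ^ (D * (D + κ + 1)) * (P (D + κ + 1) * P D)) (v + 1), ← ih,
      ← add_assoc, sum_P_succ (κ + 1 + v + 1) (v + 1),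
      show v + 1 + κ + 1 = κ + 1 + v + 1 by ring]
    linear_combination (∑ d ∈ range (v + 1), X ^ ((κ + 1 + v + 1) * d) * P d) *
      P_succ (κ + 1 + v)

lemma crankSer_eq (κ : ℕ) : crankSer κ =
    S fun i => X ^ lev κ i * (P (i + κ + 1) * P i) := by
  have h1 : ∀ v, GP (Icc 2 (κ + 1 + v)) *
      ∑ d ∈ range (v + 1), X ^ ((κ + 1 + v + 1) * d) * P d =
        (1 - X) * ∑ D ∈ range (v + 1), X ^ (D * (D + κ + 1)) * (P (D + κ + 1) * P D) := by
    intro v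
    have h := GP_Icc_left (show 1 ≤ κ + 1 + v by omega) le_rfl
    change (1 - X ^ 1) * P (κ + 1 + v) = _ at h
    rw [← P_mul_sum, ← h]; ring
  have h2 := S_antidiag fun D _ => X ^ (D * (D + κ + 1)) * (P (D + κ + 1) * P D)
  have h3 : ∀ a : Ser, (1 - X) * S (fun _ => a) = a := fun a => by
    linear_combination S_succ fun _ => a
  rw [crankSer]
  simp only [h1]
  rw [S_mul, h2, ← S_mul, ← S_mul]
  congr 1
  funext i
  rw [h3, lev]
  ring

/-- Coefficientwise, the rank series is dominated by the crank series. -/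
theorem nn_crankSer_sub_rankSer (κ : ℕ) : Nn (crankSer κ - rankSer κ) := by
  rw [crankSer_eq, rankSer_eq, ← S_sub]
  convert nn_S_dd κ using 3
  rw [dd]; ring

/-- Multisets of parts in `(lo, M]` with sum `n` and exactly `d` parts larger than `w`. -/
def boxed (lo w M d n : ℕ) : Set (Multiset ℕ) :=
  {s | (∀ x ∈ s, lo < x ∧ x ≤ M) ∧ s.countP (w < ·) = d ∧ s.sum = n}

lemma mem_boxed {lo w M d n : ℕ} {s : Multiset ℕ} : s ∈ boxed lo w M d n ↔
    (∀ x ∈ s, lo < x ∧ x ≤ M) ∧ s.countP (w < ·) = d ∧ s.sum = n := Iff.rfl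

lemma finite_pos_sum (n : ℕ) : {s : Multiset ℕ | (∀ x ∈ s, 0 < x) ∧ s.sum = n}.Finite := by
  refine (Set.finite_range (Nat.Partition.parts (n := n))).subset ?_
  rintro s ⟨h, hs⟩
  exact ⟨⟨s, fun {i} hi => h i hi, hs⟩, rfl⟩

lemma finite_boxed (lo w M d n : ℕ) : (boxed lo w M d n).Finite :=
  (finite_pos_sum n).subset fun _ h => ⟨fun x hx => Nat.zero_lt_of_lt (h.1 x hx).1, h.2.2⟩

/-- The generating function of `boxed`. -/
noncomputable def boxedSer (lo w M d : ℕ) : Ser :=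
  PowerSeries.mk fun n => ((boxed lo w M d n).ncard : ℤ)

lemma coeff_boxedSer (lo w M d n : ℕ) :
    coeff n (boxedSer lo w M d) = ((boxed lo w M d n).ncard : ℤ) := coeff_mk _ _

lemma boxed_eq_empty {lo w M d : ℕ} (hM : M ≤ w) (hd : 0 < d) (n : ℕ) :
    boxed lo w M d n = ∅ := by
  refine Set.eq_empty_of_forall_notMem fun s hs => ?_
  have : s.countP (w < ·) = 0 := Multiset.countP_eq_zero.mpr fun x hx =>
    not_lt.mpr ((hs.1 x hx).2.trans hM)
  have := hs.2.1
  omega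

lemma boxedSer_eq_zero {lo w M d : ℕ} (hM : M ≤ w) (hd : 0 < d) : boxedSer lo w M d = 0 := by
  ext n
  simp [coeff_boxedSer, boxed_eq_empty hM hd]

lemma boxedSer_base (lo w : ℕ) : boxedSer lo w lo 0 = 1 := by
  have h : ∀ n, boxed lo w lo 0 n = if n = 0 then {0} else ∅ := by
    intro n
    ext s
    rw [mem_boxed]
    constructor
    · rintro ⟨h1, h2, h3⟩
      have : s = 0 := Multiset.eq_zero_of_forall_notMem fun x hx => by
        have := h1 x hx; omega
      subst this
      simp_all
    · intro hs
      split_ifs at hs with hn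
      · rw [Set.mem_singleton_iff.mp hs]; simp [hn]
      · exact hs.elim
  ext n
  rw [coeff_boxedSer, h, coeff_one]
  split_ifs <;> simp

/-- Splitting according to whether the largest allowed part occurs. -/
lemma ncard_boxed_succ (lo w M d n : ℕ) :
    (boxed lo w (M + 1) d n).ncard = (boxed lo w M d n).ncard +
      {s | s.sum + (M + 1) = n ∧ (M + 1) ::ₘ s ∈ boxed lo w (M + 1) d n}.ncard := by
  have hu : boxed lo w (M + 1) d n = boxed lo w M d n ∪ (Multiset.cons (M + 1)) ''
      {s | s.sum + (M + 1) = n ∧ (M + 1) ::ₘ s ∈ boxed lo w (M + 1) d n} := by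
    ext s
    constructor
    · intro hs
      by_cases hM : M + 1 ∈ s
      · obtain ⟨t, rfl⟩ := Multiset.exists_cons_of_mem hM
        refine Or.inr ⟨t, ⟨?_, hs⟩, rfl⟩
        have := hs.2.2
        rw [Multiset.sum_cons] at this
        omega
      · refine Or.inl ⟨fun x hx => ?_, hs.2⟩
        have h1 := hs.1 x hx
        have h2 : x ≠ M + 1 := fun e => hM (e ▸ hx)
        omega
    · rintro (hs | ⟨t, ht, rfl⟩)
      · exact ⟨fun x hx => ⟨(hs.1 x hx).1, (hs.1 x hx).2.trans M.le_succ⟩, hs.2⟩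
      · exact ht.2
  have hinj : Function.Injective (Multiset.cons (M + 1)) := fun _ _ => (Multiset.cons_inj_right _).mp
  have hfin := finite_boxed lo w (M + 1) d n
  conv_lhs => rw [hu]
  rw [Set.ncard_union_eq ?_ (finite_boxed _ _ _ _ _) (hfin.subset ?_),
    Set.ncard_image_of_injective _ hinj]
  · rw [Set.disjoint_left]
    rintro _ hs ⟨t, -, rfl⟩
    have := (hs.1 (M + 1) (Multiset.mem_cons_self _ _)).2
    omega
  · rintro _ ⟨t, ht, rfl⟩
    exact ht.2

lemma coeff_X_pow_mul_boxedSer (j lo w M d n : ℕ) : coeff n (X ^ j * boxedSer lo w M d) =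
    ({s | s.sum + j = n ∧ s ∈ boxed lo w M d s.sum}.ncard : ℤ) := by
  rw [coeff_X_pow_mul', coeff_boxedSer]
  split_ifs with h
  · congr 2
    ext s
    constructor
    · intro hs
      have := hs.2.2
      exact ⟨by omega, hs.1, hs.2.1, rfl⟩
    · rintro ⟨h1, h2⟩
      exact ⟨h2.1, h2.2.1, by omega⟩
  · rw [Set.eq_empty_of_forall_notMem (s := {s | s.sum + j = n ∧ s ∈ boxed lo w M d s.sum})]
    · simp
    · rintro s ⟨hs, -⟩
      omega

lemma boxedSer_succ_zero {lo M w : ℕ} (h : lo ≤ M) (hw : M < w) :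
    boxedSer lo w (M + 1) 0 = geo (M + 1) * boxedSer lo w M 0 := by
  have key : boxedSer lo w (M + 1) 0 =
      boxedSer lo w M 0 + X ^ (M + 1) * boxedSer lo w (M + 1) 0 := by
    ext n
    rw [map_add, coeff_X_pow_mul_boxedSer, coeff_boxedSer, coeff_boxedSer, ncard_boxed_succ,
      Nat.cast_add]
    congr 3
    ext s
    refine and_congr_right fun hs => ?_
    simp [mem_boxed, ← hs, add_comm, hw, h]
  linear_combination geo (M + 1) * key -
    boxedSer lo w (M + 1) 0 * one_sub_mul_geo (show 1 ≤ M + 1 by omega)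

lemma boxedSer_succ_zero' (lo : ℕ) {M w : ℕ} (hw : w ≤ M) :
    boxedSer lo w (M + 1) 0 = boxedSer lo w M 0 := by
  ext n
  rw [coeff_boxedSer, coeff_boxedSer, ncard_boxed_succ,
    Set.eq_empty_of_forall_notMem
      (s := {s | s.sum + (M + 1) = n ∧ (M + 1) ::ₘ s ∈ boxed lo w (M + 1) 0 n})]
  · simp
  · rintro s ⟨-, hs⟩
    have := hs.2.1
    rw [Multiset.countP_cons_of_pos _ (by omega)] at this
    omega

lemma boxedSer_succ_succ {lo M w : ℕ} (d : ℕ) (h : lo ≤ M) (hw : w ≤ M) :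
    boxedSer lo w (M + 1) (d + 1) =
      boxedSer lo w M (d + 1) + X ^ (M + 1) * boxedSer lo w (M + 1) d := by
  ext n
  rw [map_add, coeff_X_pow_mul_boxedSer, coeff_boxedSer, coeff_boxedSer,
    ncard_boxed_succ, Nat.cast_add]
  congr 3
  ext s
  refine and_congr_right fun hs => ?_
  simp [mem_boxed, ← hs, add_comm, hw, h, Multiset.countP_cons_of_pos]

lemma boxedSer_self (lo j : ℕ) {w : ℕ} (hw : lo + j ≤ w) :
    boxedSer lo w (lo + j) 0 = GP (Icc (lo + 1) (lo + j)) := by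
  induction j with
  | zero => simp [boxedSer_base, GP]
  | succ j ih =>
    rw [← add_assoc, boxedSer_succ_zero (by omega) (by omega), ih (by omega),
      GP_Icc_last (by omega), mul_comm]

lemma boxedSer_eq {lo w : ℕ} (hw : lo ≤ w) (L d : ℕ) : boxedSer lo w (w + L) d =
    GP (Icc (lo + 1) w) * (X ^ ((w + 1) * d) * gb (d + L - 1) d) := by
  obtain ⟨j, rfl⟩ := Nat.exists_eq_add_of_le hw
  induction L generalizing d with
  | zero =>
    rcases Nat.eq_zero_or_pos d with rfl | hd
    · simpa using boxedSer_self lo j le_rfl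
    · rw [add_zero, boxedSer_eq_zero le_rfl hd, gb_eq_zero (by omega)]; simp
  | succ L ih =>
    induction d with
    | zero => rw [← add_assoc, boxedSer_succ_zero' _ (by omega), ih 0]; simp
    | succ d ihd =>
      rw [← add_assoc, boxedSer_succ_succ d (by omega) (by omega), ih (d + 1),
        add_assoc (lo + j) L 1, ihd,
        show d + 1 + (L + 1) - 1 = d + L + 1 by omega, show d + 1 + L - 1 = d + L by omega,
        show d + (L + 1) - 1 = d + L by omega, gb_pascal', Nat.add_sub_cancel_left]
      ring

open RankCrank

lemma natCard_fiberwise {α β : Type*} [Finite α] [DecidableEq β] (p : α → Prop) (g : α → β)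
    (t : Finset β) (h : ∀ a, p a → g a ∈ t) :
    Nat.card {a // p a} = ∑ b ∈ t, Nat.card {a // p a ∧ g a = b} := by
  classical
  have := Fintype.ofFinite α
  simp only [Nat.card_eq_fintype_card, Fintype.card_subtype, ← filter_filter]
  exact card_eq_sum_card_fiberwise fun a ha => h a (by simpa using ha)

lemma natCard_partition (n : ℕ) (Q : Multiset ℕ → Prop) :
    Nat.card {l : n.Partition // Q l.parts} =
      {s : Multiset ℕ | ((∀ x ∈ s, 0 < x) ∧ s.sum = n) ∧ Q s}.ncard := by
  have hinj : Function.Injective (Nat.Partition.parts (n := n)) := fun _ _ => Nat.Partition.ext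
  change Nat.card {l : n.Partition | Q l.parts} = _
  rw [Nat.card_coe_set_eq, ← Set.ncard_image_of_injective _ hinj]
  congr 1
  ext s
  constructor
  · rintro ⟨l, hl, rfl⟩
    exact ⟨⟨fun x hx => l.parts_pos hx, l.parts_sum⟩, hl⟩
  · rintro ⟨⟨h1, h2⟩, h3⟩
    exact ⟨⟨s, fun {i} hi => h1 i hi, h2⟩, h3, rfl⟩

lemma card_parts_le {n : ℕ} (l : n.Partition) : l.parts.card ≤ n := by
  have h := Multiset.card_nsmul_le_sum (s := l.parts) (a := 1) fun x hx => l.parts_pos hx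
  simpa [l.parts_sum] using h

lemma part_one_le_iff {n : ℕ} (l : n.Partition) (M : ℕ) :
    part l 1 ≤ M ↔ ∀ x ∈ l.parts, x ≤ M := by
  have hmem : ∀ x, x ∈ (l.parts.sort (· ≤ ·)).reverse ↔ x ∈ l.parts := by simp
  have hs : (l.parts.sort (· ≤ ·)).reverse.Pairwise (fun a b => b ≤ a) :=
    List.pairwise_reverse.mpr (Multiset.pairwise_sort _ _)
  simp only [part, ← hmem]
  cases h : (l.parts.sort (· ≤ ·)).reverse with
  | nil => simp
  | cons a L =>
    rw [h, List.pairwise_cons] at hs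
    simpa using fun ha x hx => (hs.1 x hx).trans ha

lemma sum_card_eq {n : ℕ} (f : n.Partition → ℤ) (hf : ∀ l, -(n : ℤ) ≤ f l) (m : ℤ) :
    ∑ r ∈ Icc (-(n : ℤ)) m, (Nat.card {l // f l = r} : ℤ) = Nat.card {l // f l ≤ m} := by
  rw [natCard_fiberwise (fun l => f l ≤ m) f (Icc (-(n : ℤ)) m)
    fun l hl => mem_Icc.mpr ⟨hf l, hl⟩, Nat.cast_sum]
  refine sum_congr rfl fun r hr => ?_
  congr 1
  refine Nat.card_congr (Equiv.subtypeEquivRight fun l => ?_)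
  have := (mem_Icc.mp hr).2
  constructor <;> intro h <;> omega

lemma neg_le_rank {n : ℕ} (l : n.Partition) : -(n : ℤ) ≤ rank l := by
  have := card_parts_le l
  rw [rank]; omega

lemma neg_le_crank {n : ℕ} (l : n.Partition) : -(n : ℤ) ≤ crank l := by
  have h1 := card_parts_le l
  have h2 := l.parts.count_le_card 1
  rw [crank]
  split_ifs <;> omega

lemma coeff_X_pow_mul_S (j n : ℕ) (f : ℕ → Ser) : coeff n (X ^ j * S f) =
    ∑ t ∈ range (n + 1), coeff n (X ^ (j + t) * f t) := by
  rw [← S_mul, coeff_S]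
  refine sum_congr rfl fun t _ => ?_
  congr 1
  ring

lemma rank_le_iff {n : ℕ} (l : n.Partition) (κ : ℕ) :
    rank l ≤ -((κ : ℤ) + 1) ↔ part l 1 + κ + 1 ≤ l.parts.card := by
  rw [rank]; omega

lemma coeff_rankSer {n : ℕ} (hn : 1 ≤ n) (κ : ℕ) :
    coeff n (rankSer κ) = (Nat.card {l : n.Partition // rank l ≤ -((κ : ℤ) + 1)} : ℤ) := by
  have hpos : ∀ l : n.Partition, 1 ≤ part l 1 := fun l => by
    by_contra h
    have h0 := (part_one_le_iff l 0).mp (by omega)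
    have := Multiset.sum_eq_zero fun x hx => Nat.le_zero.mp (h0 x hx)
    have := l.parts_sum
    omega
  rw [natCard_fiberwise _ (fun l => l.parts.card - (κ + 2)) (range (n + 1)) fun l _ => by
    have := card_parts_le l
    simp only [mem_range]; omega, rankSer, coeff_X_pow_mul_S, Nat.cast_sum]
  refine sum_congr rfl fun c _ => ?_
  have h := boxedSer_eq (le_refl 0) (c + 1) (κ + 2 + c)
  rw [show X ^ (κ + 2 + c) * bx (c + 1 + (κ + 1)) c = boxedSer 0 0 (0 + (c + 1)) (κ + 2 + c) by
    rw [h, bx, show c + 1 + (κ + 1) + c = κ + 2 + c + (c + 1) - 1 by omega,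
      show c + 1 + (κ + 1) = κ + 2 + c by omega]
    simp [GP], coeff_boxedSer]
  congr 1
  have h2 : ∀ l : n.Partition, (rank l ≤ -((κ : ℤ) + 1) ∧ l.parts.card - (κ + 2) = c) ↔
      ((∀ x ∈ l.parts, x ≤ c + 1) ∧ l.parts.card = κ + 2 + c) := fun l => by
    rw [← part_one_le_iff, rank_le_iff]
    have := hpos l
    omega
  rw [Nat.card_congr (Equiv.subtypeEquivRight h2),
    natCard_partition n fun s => (∀ x ∈ s, x ≤ c + 1) ∧ s.card = κ + 2 + c]
  congr 1
  ext s
  have hc : (∀ x ∈ s, 0 < x) → s.countP (0 < ·) = s.card := Multiset.countP_eq_card.mpr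
  rw [mem_boxed]
  constructor
  · rintro ⟨h1, h2, h3⟩
    have h4 : ∀ x ∈ s, 0 < x := fun x hx => (h1 x hx).1
    exact ⟨⟨h4, h3⟩, fun x hx => by simpa using (h1 x hx).2, hc h4 ▸ h2⟩
  · rintro ⟨⟨h4, h3⟩, h1, h2⟩
    exact ⟨fun x hx => ⟨h4 x hx, by simpa using h1 x hx⟩, (hc h4).trans h2, h3⟩

lemma crank_le_iff {n : ℕ} (l : n.Partition) (κ : ℕ) : crank l ≤ -((κ : ℤ) + 1) ↔
    l.parts.countP (l.parts.count 1 < ·) + κ + 1 ≤ l.parts.count 1 := by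
  rw [crank, Multiset.countP_eq_card_filter]
  split_ifs <;> omega

/-- Partitions with `w` ones and `d` parts larger than `w`. -/
lemma natCard_count_one (n d : ℕ) {w : ℕ} (hw : 1 ≤ w) :
    (Nat.card {l : n.Partition // l.parts.count 1 = w ∧ l.parts.countP (w < ·) = d} : ℤ) =
      coeff n (X ^ w * boxedSer 1 w (w + (n + 1)) d) := by
  rw [natCard_partition n fun s => s.count 1 = w ∧ s.countP (w < ·) = d,
    coeff_X_pow_mul_boxedSer, ← Set.ncard_image_of_injective
      {s | s.sum + w = n ∧ s ∈ boxed 1 w (w + (n + 1)) d s.sum}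
      (add_right_injective (Multiset.replicate w 1))]
  congr 2
  ext s
  constructor
  · rintro ⟨⟨h1, h2⟩, h3, h4⟩
    have hs : Multiset.replicate w 1 + s.filter (· ≠ 1) = s := by
      rw [← h3, ← Multiset.filter_eq']
      exact Multiset.filter_add_not _ _
    rw [← hs] at h2 h4
    rw [Multiset.sum_add, Multiset.sum_replicate, smul_eq_mul, mul_one] at h2
    rw [Multiset.countP_add, Multiset.countP_eq_zero.mpr fun x hx => by
      rw [Multiset.eq_of_mem_replicate hx]; omega, zero_add] at h4
    refine ⟨_, ⟨by omega, ⟨fun x hx => ?_, h4, rfl⟩⟩, hs⟩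
    have h5 := Multiset.le_sum_of_mem hx
    have h6 := h1 x (Multiset.mem_of_mem_filter hx)
    have h7 := (Multiset.mem_filter.mp hx).2
    omega
  · rintro ⟨t, ⟨h1, h2, h3, -⟩, rfl⟩
    refine ⟨⟨fun x hx => ?_, ?_⟩, ?_, ?_⟩
    · rcases Multiset.mem_add.mp hx with hx | hx
      · rw [Multiset.eq_of_mem_replicate hx]; omega
      · exact Nat.zero_lt_of_lt (h2 x hx).1
    · simp only [Multiset.sum_add, Multiset.sum_replicate, smul_eq_mul]; omega
    · have : (1 : ℕ) ∉ t := fun h => (h2 1 h).1.false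
      simp [Multiset.count_eq_zero_of_notMem this]
    · simp only [Multiset.countP_add, h3]
      rw [Multiset.countP_eq_zero.mpr fun x hx => by
        rw [Multiset.eq_of_mem_replicate hx]; omega, zero_add]

lemma coeff_crankSer (n κ : ℕ) :
    coeff n (crankSer κ) = (Nat.card {l : n.Partition // crank l ≤ -((κ : ℤ) + 1)} : ℤ) := by
  rw [natCard_fiberwise _ (fun l => l.parts.count 1 - (κ + 1)) (range (n + 1)) fun l _ => by
    have := card_parts_le l
    have := l.parts.count_le_card 1
    simp only [mem_range]; omega, crankSer, coeff_X_pow_mul_S, Nat.cast_sum]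
  refine sum_congr rfl fun v _ => ?_
  have h1 : ∀ l : n.Partition,
      (crank l ≤ -((κ : ℤ) + 1) ∧ l.parts.count 1 - (κ + 1) = v) ↔
        (l.parts.count 1 = κ + 1 + v ∧ l.parts.countP (κ + 1 + v < ·) ≤ v) := fun l => by
    rw [crank_le_iff]
    constructor
    · rintro ⟨h1, h2⟩
      have h3 : l.parts.count 1 = κ + 1 + v := by omega
      rw [h3] at h1
      omega
    · rintro ⟨h1, h2⟩
      rw [h1]
      omega
  rw [Nat.card_congr (Equiv.subtypeEquivRight h1),
    natCard_fiberwise _ (fun l => l.parts.countP (κ + 1 + v < ·)) (range (v + 1)) fun l hl =>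
      mem_range.mpr (Nat.lt_succ_of_le hl.2), mul_sum, mul_sum, map_sum, Nat.cast_sum]
  refine sum_congr rfl fun d hd => ?_
  have h2 : ∀ l : n.Partition, ((l.parts.count 1 = κ + 1 + v ∧
      l.parts.countP (κ + 1 + v < ·) ≤ v) ∧ l.parts.countP (κ + 1 + v < ·) = d) ↔
      (l.parts.count 1 = κ + 1 + v ∧ l.parts.countP (κ + 1 + v < ·) = d) := fun l => by
    have := mem_range.mp hd
    omega
  rw [Nat.card_congr (Equiv.subtypeEquivRight h2), natCard_count_one n d (by omega),
    boxedSer_eq (by omega), ← sub_eq_zero, ← map_sub]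
  refine (X_pow_dvd_iff.mp ?_) n n.lt_succ_self
  convert (X_pow_dvd_P_sub_bx d n).mul_left
    (X ^ (κ + 1 + v) * GP (Icc 2 (κ + 1 + v)) * X ^ ((κ + 1 + v + 1) * d)) using 1
  rw [bx, show d + (n + 1) - 1 = d + n by omega]
  ring

lemma natCard_rank_le_crank {n : ℕ} (hn : 1 ≤ n) (κ : ℕ) :
    (Nat.card {l : n.Partition // rank l ≤ -((κ : ℤ) + 1)} : ℤ) ≤
      Nat.card {l : n.Partition // crank l ≤ -((κ : ℤ) + 1)} := by
  rw [← coeff_rankSer hn, ← coeff_crankSer, ← sub_nonneg, ← map_sub]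
  exact nn_crankSer_sub_rankSer κ n

end QSer

open RankCrank in
/-- For every negative integer `m` and every `n ≥ 1`, `N(≤ m, n) ≤ M(≤ m, n)`. -/
theorem Nle_le_Mle (m : ℤ) (hm : m < 0) (n : ℕ) (hn : 1 ≤ n) :
    Nle m n ≤ Mle m n := by
  obtain ⟨κ, rfl⟩ : ∃ κ : ℕ, m = -((κ : ℤ) + 1) := ⟨(-m - 1).toNat, by omega⟩
  have hN : Nle (-((κ : ℤ) + 1)) n =
      Nat.card {l : n.Partition // rank l ≤ -((κ : ℤ) + 1)} :=
    QSer.sum_card_eq rank QSer.neg_le_rank _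
  rw [hN]
  rcases eq_or_ne n 1 with rfl | hn1
  · have h0 : Nat.card {l : Nat.Partition 1 // rank l ≤ -((κ : ℤ) + 1)} = 0 := by
      have hκ := QSer.coeff_rankSer le_rfl κ
      rw [QSer.rankSer, PowerSeries.coeff_X_pow_mul', if_neg (by omega)] at hκ
      exact_mod_cast hκ.symm
    rw [h0, Mle]
    refine Finset.sum_nonneg fun r hr => ?_
    have := (Finset.mem_Icc.mp hr).2
    rw [M, if_pos rfl, if_neg (by omega)]
    split_ifs <;> simp
  · have hM : Mle (-((κ : ℤ) + 1)) n =
        Nat.card {l : n.Partition // crank l ≤ -((κ : ℤ) + 1)} := by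
      rw [← QSer.sum_card_eq crank QSer.neg_le_crank, Mle]
      exact Finset.sum_congr rfl fun r _ => if_neg hn1
    rw [hM]
    exact QSer.natCard_rank_le_crank hn κ
end

section
/- For every negative integer m and every integer n ≥ 1, the number of partitions of n with crank at most m is at most the number of partitions of n with rank at most m+1, i.e., M(≤ m, n) ≤ N(≤ m+1, n). -/
open scoped BigOperators

namespace RankCrankSeries

open PowerSeries
open scoped PowerSeries.WithPiTopology

/-- The Gaussian binomial coefficient as a power series in `X`. -/
noncomputable def gaussBinom : ℕ → ℕ → ℤ⟦X⟧
  | _, 0 => 1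
  | 0, _ + 1 => 0
  | n + 1, k + 1 => gaussBinom n k + X ^ (k + 1) * gaussBinom n (k + 1)

@[simp] lemma gaussBinom_zero_right (n : ℕ) : gaussBinom n 0 = 1 := by
  cases n <;> rfl

lemma gaussBinom_succ_succ (n k : ℕ) :
    gaussBinom (n + 1) (k + 1) = gaussBinom n k + X ^ (k + 1) * gaussBinom n (k + 1) := rfl

lemma gaussBinom_eq_zero_of_lt : ∀ {n k : ℕ}, n < k → gaussBinom n k = 0
  | 0, _ + 1, _ => rfl
  | n + 1, k + 1, h => by
    rw [gaussBinom_succ_succ, gaussBinom_eq_zero_of_lt (by omega : n < k),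
      gaussBinom_eq_zero_of_lt (by omega : n < k + 1)]
    simp

@[simp] lemma gaussBinom_self : ∀ n : ℕ, gaussBinom n n = 1
  | 0 => rfl
  | n + 1 => by
    rw [gaussBinom_succ_succ, gaussBinom_self n, gaussBinom_eq_zero_of_lt (Nat.lt_succ_self n)]
    simp

/-- The second Pascal rule for Gaussian binomial coefficients. -/
lemma gaussBinom_add_succ (a k : ℕ) :
    gaussBinom (a + k + 1) (k + 1) =
      X ^ a * gaussBinom (a + k) k + gaussBinom (a + k) (k + 1) := by
  suffices h : ∀ n a k : ℕ, a + k = n → gaussBinom (n + 1) (k + 1) =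
      X ^ a * gaussBinom n k + gaussBinom n (k + 1) from h _ a k rfl
  intro n
  induction n with
  | zero =>
    intro a k h
    obtain ⟨rfl, rfl⟩ : a = 0 ∧ k = 0 := by omega
    simp [gaussBinom_eq_zero_of_lt]
  | succ n ih =>
    intro a k h
    rcases a with _ | a
    · obtain rfl : k = n + 1 := by omega
      simp [gaussBinom_eq_zero_of_lt]
    rcases k with _ | k
    · obtain rfl : a = n := by omega
      have := ih a 0 rfl
      rw [gaussBinom_succ_succ, this]
      rw [gaussBinom_succ_succ] at this
      simp only [gaussBinom_zero_right] at this ⊢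
      linear_combination this
    · have h1 := ih (a + 1) k (by omega)
      have h2 := ih a (k + 1) (by omega)
      rw [gaussBinom_succ_succ, gaussBinom_succ_succ n k, gaussBinom_succ_succ n (k + 1)]
      rw [gaussBinom_succ_succ] at h1 h2
      linear_combination h1 + X ^ (k + 2) * h2

lemma gaussBinom_symm (a b : ℕ) : gaussBinom (a + b) a = gaussBinom (a + b) b := by
  suffices h : ∀ n a b : ℕ, a + b = n → gaussBinom n a = gaussBinom n b from h _ a b rfl
  intro n
  induction n with
  | zero => intro a b h; obtain ⟨rfl, rfl⟩ : a = 0 ∧ b = 0 := by omega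
            rfl
  | succ n ih =>
    intro a b h
    rcases a with _ | a
    · obtain rfl : b = n + 1 := by omega
      simp
    rcases b with _ | b
    · obtain rfl : a = n := by omega
      simp
    obtain rfl : n = b + 1 + a := by omega
    rw [gaussBinom_add_succ (b + 1) a, gaussBinom_succ_succ _ b, ih a (b + 1) (by omega),
      ih (a + 1) b (by omega)]
    ring

/-- The `q`-Vandermonde identity. -/
lemma gaussBinom_add (m n k : ℕ) :
    gaussBinom (m + n) k = ∑ x ∈ Finset.HasAntidiagonal.antidiagonal k,
      X ^ (x.2 * (m - x.1)) * gaussBinom m x.1 * gaussBinom n x.2 := by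
  induction m generalizing k with
  | zero =>
    rw [Finset.sum_eq_single (0, k)]
    · simp
    · rintro ⟨x, y⟩ hx hne
      have : 0 < x := by
        simp only [Finset.HasAntidiagonal.mem_antidiagonal, ne_eq, Prod.mk.injEq] at hx hne
        omega
      simp [gaussBinom_eq_zero_of_lt this]
    · simp
  | succ m ih =>
    rcases k with _ | k
    · simp
    rw [show m + 1 + n = m + n + 1 by ring, gaussBinom_succ_succ, ih, ih,
      Finset.Nat.antidiagonal_succ, Finset.sum_cons, Finset.sum_cons, Finset.sum_map,
      Finset.sum_map, mul_add, Finset.mul_sum]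
    have key : ∀ x ∈ Finset.HasAntidiagonal.antidiagonal k,
        X ^ (x.2 * (m + 1 - (x.1 + 1))) * gaussBinom (m + 1) (x.1 + 1) * gaussBinom n x.2 =
        X ^ (x.2 * (m - x.1)) * gaussBinom m x.1 * gaussBinom n x.2 +
        X ^ (k + 1) *
          (X ^ (x.2 * (m - (x.1 + 1))) * gaussBinom m (x.1 + 1) * gaussBinom n x.2) := by
      rintro ⟨x, y⟩ hx
      simp only [Finset.HasAntidiagonal.mem_antidiagonal] at hx
      subst hx
      simp only [Nat.add_sub_add_right, gaussBinom_succ_succ]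
      rcases lt_or_ge x m with hxm | hxm
      · obtain ⟨c, rfl⟩ : ∃ c, m = x + 1 + c := ⟨m - (x + 1), by omega⟩
        rw [show x + 1 + c - x = c + 1 by omega, show x + 1 + c - (x + 1) = c by omega]
        ring
      · rw [gaussBinom_eq_zero_of_lt (by omega : m < x + 1)]
        ring
    simp only [Function.Embedding.prodMap, Function.Embedding.coeFn_mk, Prod.map_fst,
      Prod.map_snd, Function.Embedding.refl_apply, Nat.succ_eq_add_one]
    rw [Finset.sum_congr rfl key, Finset.sum_add_distrib]
    simp only [Nat.sub_zero, gaussBinom_zero_right]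
    ring

/-- The generating function of the partitions with exactly `r` parts, all at most `A`. -/
noncomputable def exactGF (A r : ℕ) : ℤ⟦X⟧ := X ^ r * gaussBinom (A + r - 1) r

/-- The generating function of the partitions with at most `r` parts, all at most `A`. -/
noncomputable def boundGF (A r : ℕ) : ℤ⟦X⟧ := gaussBinom (A + r) r

@[simp] lemma exactGF_zero_right (A : ℕ) : exactGF A 0 = 1 := by simp [exactGF]

@[simp] lemma boundGF_zero_right (A : ℕ) : boundGF A 0 = 1 := by simp [boundGF]

@[simp] lemma boundGF_zero_left (r : ℕ) : boundGF 0 r = 1 := by simp [boundGF]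

@[simp] lemma exactGF_zero_succ (r : ℕ) : exactGF 0 (r + 1) = 0 := by
  simp [exactGF, gaussBinom_eq_zero_of_lt]

lemma exactGF_succ_left (A r : ℕ) : exactGF (A + 1) r = X ^ r * boundGF A r := by
  simp [exactGF, boundGF, show A + 1 + r - 1 = A + r by omega]

lemma boundGF_succ_right (A r : ℕ) : boundGF A (r + 1) = boundGF A r + exactGF A (r + 1) := by
  simp [exactGF, boundGF, ← add_assoc, gaussBinom_succ_succ]

lemma exactGF_succ_succ (A r : ℕ) :
    exactGF (A + 1) (r + 1) = exactGF A (r + 1) + X ^ (A + 1) * exactGF (A + 1) r := by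
  simp only [exactGF, show A + 1 + (r + 1) - 1 = A + r + 1 by omega,
    show A + (r + 1) - 1 = A + r by omega, show A + 1 + r - 1 = A + r by omega,
    gaussBinom_add_succ]
  ring

lemma boundGF_succ_succ (A r : ℕ) :
    boundGF (A + 1) (r + 1) = boundGF A (r + 1) + X ^ (A + 1) * boundGF (A + 1) r := by
  simp only [boundGF]
  rw [← add_assoc, gaussBinom_add_succ, show A + 1 + r = A + (r + 1) by ring]
  ring

lemma X_pow_dvd_exactGF (A r d : ℕ) : X ^ r ∣ exactGF A (r + d) :=
  (pow_dvd_pow X (Nat.le_add_right r d)).mul_right _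

/-- Coefficientwise comparison of power series. -/
def CoeffLE (f g : ℤ⟦X⟧) : Prop := ∀ n, coeff n f ≤ coeff n g

lemma CoeffLE.refl (f : ℤ⟦X⟧) : CoeffLE f f := fun _ => le_rfl

lemma CoeffLE.trans {f g h : ℤ⟦X⟧} (h₁ : CoeffLE f g) (h₂ : CoeffLE g h) : CoeffLE f h :=
  fun n => (h₁ n).trans (h₂ n)

lemma CoeffLE.add {f g f' g' : ℤ⟦X⟧} (h : CoeffLE f g) (h' : CoeffLE f' g') :
    CoeffLE (f + f') (g + g') := fun n => by
  simpa using add_le_add (h n) (h' n)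

lemma CoeffLE.mul_left {f g k : ℤ⟦X⟧} (h : CoeffLE f g) (hk : CoeffLE 0 k) :
    CoeffLE (k * f) (k * g) := fun n => by
  simp only [coeff_mul]
  exact Finset.sum_le_sum fun x _ => mul_le_mul_of_nonneg_left (h _) (by simpa using hk x.1)

lemma CoeffLE.mul_right {f g k : ℤ⟦X⟧} (h : CoeffLE f g) (hk : CoeffLE 0 k) :
    CoeffLE (f * k) (g * k) := by
  simpa only [mul_comm _ k] using h.mul_left hk

lemma CoeffLE.zero_mul {f g : ℤ⟦X⟧} (hf : CoeffLE 0 f) (hg : CoeffLE 0 g) :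
    CoeffLE 0 (f * g) := by
  simpa using hg.mul_left hf

lemma CoeffLE.zero_add {f g : ℤ⟦X⟧} (hf : CoeffLE 0 f) (hg : CoeffLE 0 g) :
    CoeffLE 0 (f + g) := by
  simpa using hf.add hg

lemma coeffLE_zero_X_pow (k : ℕ) : CoeffLE 0 (X ^ k) := fun n => by
  rw [coeff_X_pow]
  split <;> simp

lemma coeffLE_zero_gaussBinom : ∀ n k : ℕ, CoeffLE 0 (gaussBinom n k)
  | n, 0 => by simpa using coeffLE_zero_X_pow 0
  | 0, _ + 1 => CoeffLE.refl 0
  | n + 1, k + 1 => (coeffLE_zero_gaussBinom n k).zero_add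
      ((coeffLE_zero_X_pow _).zero_mul (coeffLE_zero_gaussBinom n (k + 1)))

lemma coeffLE_zero_exactGF (A r : ℕ) : CoeffLE 0 (exactGF A r) :=
  (coeffLE_zero_X_pow _).zero_mul (coeffLE_zero_gaussBinom _ _)

lemma coeffLE_zero_boundGF (A r : ℕ) : CoeffLE 0 (boundGF A r) := coeffLE_zero_gaussBinom _ _

lemma boundGF_le_succ (A r : ℕ) : CoeffLE (boundGF A r) (boundGF A (r + 1)) := by
  rw [boundGF_succ_right]
  simpa using (CoeffLE.refl (boundGF A r)).add (coeffLE_zero_exactGF A (r + 1))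

lemma X_mul_exactGF_le (A r : ℕ) :
    CoeffLE (X * exactGF (A + 1) r) (exactGF (A + 1) (r + 1)) := by
  rw [exactGF_succ_left, exactGF_succ_left, ← mul_assoc, ← pow_succ']
  exact (boundGF_le_succ A r).mul_left (coeffLE_zero_X_pow _)

lemma summable_of_X_pow_dvd {f : ℕ → ℤ⟦X⟧} (h : ∀ r, X ^ r ∣ f r) : Summable f := by
  rw [PowerSeries.WithPiTopology.summable_iff_summable_coeff]
  intro n
  refine summable_of_ne_finset_zero (s := Finset.range (n + 1)) fun r hr => ?_
  exact (X_pow_dvd_iff.1 (h r)) n (by simpa using hr)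

lemma coeff_tsum {f : ℕ → ℤ⟦X⟧} (h : Summable f) (n : ℕ) :
    coeff n (∑' r, f r) = ∑' r, coeff n (f r) :=
  (((PowerSeries.WithPiTopology.hasSum_iff_hasSum_coeff ℤ).1 h.hasSum) n).tsum_eq.symm

lemma CoeffLE.tsum {f g : ℕ → ℤ⟦X⟧} (hf : Summable f) (hg : Summable g)
    (h : ∀ r, CoeffLE (f r) (g r)) : CoeffLE (∑' r, f r) (∑' r, g r) := fun n => by
  rw [coeff_tsum hf, coeff_tsum hg]
  exact Summable.tsum_le_tsum (fun r => h r n)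
    ((PowerSeries.WithPiTopology.summable_iff_summable_coeff ℤ).1 hf n)
    ((PowerSeries.WithPiTopology.summable_iff_summable_coeff ℤ).1 hg n)

lemma CoeffLE.zero_tsum {f : ℕ → ℤ⟦X⟧} (hf : Summable f)
    (h : ∀ r, CoeffLE 0 (f r)) : CoeffLE 0 (∑' r, f r) := by
  simpa using CoeffLE.tsum (f := fun _ => 0) summable_zero hf h

lemma CoeffLE.sum_le_tsum {f : ℕ → ℤ⟦X⟧} (hf : Summable f)
    (h : ∀ r, CoeffLE 0 (f r)) (K : ℕ) : CoeffLE (∑ r ∈ Finset.range K, f r) (∑' r, f r) :=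
  fun n => by
    rw [coeff_tsum hf, map_sum]
    exact Summable.sum_le_tsum _ (fun r _ => by simpa using h r n)
      ((PowerSeries.WithPiTopology.summable_iff_summable_coeff ℤ).1 hf n)

/-- The generating function of the partitions with all parts at most `k`. -/
noncomputable def partGF : ℕ → ℤ⟦X⟧
  | 0 => 1
  | k + 1 => partGF k * invOfUnit (1 - X ^ (k + 1)) 1

@[simp] lemma partGF_zero : partGF 0 = 1 := rfl

lemma one_sub_X_pow_mul_partGF (k : ℕ) : (1 - X ^ (k + 1)) * partGF (k + 1) = partGF k := by
  rw [partGF, mul_left_comm, mul_invOfUnit _ _ (by simp), mul_one]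

lemma one_sub_X_pow_ne_zero (k : ℕ) : (1 - X ^ (k + 1) : ℤ⟦X⟧) ≠ 0 := fun h => by
  simpa using congrArg constantCoeff h

/-- The sum `∑ r, exactGF A (r + d) * boundGF B r`. -/
noncomputable def exactBound (d A B : ℕ) : ℤ⟦X⟧ := ∑' r, exactGF A (r + d) * boundGF B r

/-- The sum `∑ r, boundGF A (r + d) * exactGF B r`. -/
noncomputable def boundExact (d A B : ℕ) : ℤ⟦X⟧ := ∑' r, boundGF A (r + d) * exactGF B r

/-- The sum `∑ r, boundGF A r * exactGF B (r + 1)`. -/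
noncomputable def boundExactShift (A B : ℕ) : ℤ⟦X⟧ := ∑' r, boundGF A r * exactGF B (r + 1)

lemma summable_exactGF_mul (f : ℕ → ℤ⟦X⟧) (d A : ℕ) :
    Summable fun r => exactGF A (r + d) * f r :=
  summable_of_X_pow_dvd fun r => (X_pow_dvd_exactGF A r d).mul_right _

lemma summable_mul_exactGF_add (f : ℕ → ℤ⟦X⟧) (d A : ℕ) :
    Summable fun r => f r * exactGF A (r + d) :=
  summable_of_X_pow_dvd fun r => (X_pow_dvd_exactGF A r d).mul_left _

lemma summable_mul_exactGF (f : ℕ → ℤ⟦X⟧) (A : ℕ) : Summable fun r => f r * exactGF A r :=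
  summable_mul_exactGF_add f 0 A

lemma coeffLE_zero_exactBound (d A B : ℕ) : CoeffLE 0 (exactBound d A B) :=
  CoeffLE.zero_tsum (summable_exactGF_mul _ _ _)
    fun _ => (coeffLE_zero_exactGF _ _).zero_mul (coeffLE_zero_boundGF _ _)

lemma exactBound_eq_add (d A B : ℕ) :
    exactBound d A B = exactGF A d + ∑' r, exactGF A (r + 1 + d) * boundGF B (r + 1) := by
  rw [exactBound, (summable_exactGF_mul _ _ _).tsum_eq_zero_add]
  simp

lemma boundExact_eq_add (d A B : ℕ) :
    boundExact d A B = boundGF A d + ∑' r, boundGF A (r + 1 + d) * exactGF B (r + 1) := by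
  rw [boundExact, (summable_mul_exactGF _ _).tsum_eq_zero_add]
  simp

lemma exactBound_succ_right (d A B : ℕ) :
    exactBound d A (B + 1) = exactBound d A B + X ^ (B + 1) * exactBound (d + 1) A (B + 1) := by
  have h₁ := summable_exactGF_mul (fun r => boundGF B (r + 1)) (d + 1) A
  have h₂ := summable_exactGF_mul (fun r => boundGF (B + 1) r) (d + 1) A
  rw [exactBound_eq_add, exactBound_eq_add d A B, exactBound, ← Summable.tsum_mul_left _ h₂,
    add_assoc,
    ← Summable.tsum_add (by simpa only [add_right_comm _ 1, add_assoc] using h₁)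
      (h₂.mul_left _)]
  congr 1
  refine tsum_congr fun r => ?_
  rw [boundGF_succ_succ, show r + 1 + d = r + (d + 1) by ring]
  ring

lemma exactBound_succ_left (d A B : ℕ) :
    exactBound (d + 1) (A + 1) B =
      exactBound (d + 1) A B + X ^ (A + 1) * exactBound d (A + 1) B := by
  rw [exactBound, exactBound, exactBound, ← Summable.tsum_mul_left _ (summable_exactGF_mul _ _ _),
    ← Summable.tsum_add (summable_exactGF_mul _ _ _) ((summable_exactGF_mul _ _ _).mul_left _)]
  refine tsum_congr fun r => ?_
  rw [← add_assoc, exactGF_succ_succ]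
  ring

lemma boundExact_succ_left (d A B : ℕ) :
    boundExact (d + 1) (A + 1) B =
      boundExact (d + 1) A B + X ^ (A + 1) * boundExact d (A + 1) B := by
  rw [boundExact, boundExact, boundExact, ← Summable.tsum_mul_left _ (summable_mul_exactGF _ _),
    ← Summable.tsum_add (summable_mul_exactGF _ _) ((summable_mul_exactGF _ _).mul_left _)]
  refine tsum_congr fun r => ?_
  rw [← add_assoc, boundGF_succ_succ]
  ring

lemma boundExact_zero_succ_left (A B : ℕ) :
    boundExact 0 (A + 1) B = boundExact 0 A B + X ^ (A + 1) * boundExactShift (A + 1) B := by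
  rw [boundExact_eq_add, boundExact_eq_add 0 A, boundExactShift,
    ← Summable.tsum_mul_left _ (summable_mul_exactGF_add _ 1 _), add_assoc,
    ← Summable.tsum_add (summable_mul_exactGF_add _ 1 _)
      ((summable_mul_exactGF_add _ 1 _).mul_left _)]
  simp only [boundGF_zero_right, add_zero]
  congr 1
  refine tsum_congr fun r => ?_
  rw [boundGF_succ_succ]
  ring

lemma boundExact_succ_right (d A B : ℕ) :
    boundExact d A (B + 1) = boundExact d A B + X ^ (B + 1) * boundExact (d + 1) A (B + 1) := by
  rw [boundExact_eq_add, boundExact_eq_add d A B, boundExact,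
    ← Summable.tsum_mul_left _ (summable_mul_exactGF _ _), add_assoc,
    ← Summable.tsum_add (summable_mul_exactGF_add _ 1 _) ((summable_mul_exactGF _ _).mul_left _)]
  congr 1
  refine tsum_congr fun r => ?_
  rw [exactGF_succ_succ, show r + 1 + d = r + (d + 1) by ring]
  ring

lemma exactBound_succ_eq_boundExact (d A B : ℕ) :
    exactBound d (A + 1) B = X ^ d * boundExact d A (B + 1) := by
  rw [exactBound, boundExact, ← Summable.tsum_mul_left _ (summable_mul_exactGF _ _)]
  refine tsum_congr fun r => ?_
  rw [exactGF_succ_left, exactGF_succ_left]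
  ring

lemma boundExact_le_succ (d A B : ℕ) : CoeffLE (boundExact d A B) (boundExact (d + 1) A B) :=
  CoeffLE.tsum (summable_mul_exactGF _ _) (summable_mul_exactGF _ _)
    fun _ => (boundGF_le_succ _ _).mul_right (coeffLE_zero_exactGF _ _)

lemma X_mul_boundExact_zero_le (A B : ℕ) :
    CoeffLE (X * boundExact 0 A (B + 1)) (boundExactShift A (B + 1)) := by
  rw [boundExact, ← Summable.tsum_mul_left _ (summable_mul_exactGF _ _)]
  refine CoeffLE.tsum ((summable_mul_exactGF _ _).mul_left _) (summable_mul_exactGF_add _ 1 _)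
    fun r => ?_
  rw [mul_left_comm]
  exact (X_mul_exactGF_le B r).mul_left (coeffLE_zero_boundGF _ _)

lemma X_mul_boundExact_succ_le (d A B : ℕ) :
    CoeffLE (X * boundExact (d + 1) A (B + 1)) (boundExact d A (B + 1)) := by
  have h : CoeffLE (X * boundExact (d + 1) A (B + 1))
      (∑' r, boundGF A (r + 1 + d) * exactGF (B + 1) (r + 1)) := by
    rw [boundExact, ← Summable.tsum_mul_left _ (summable_mul_exactGF _ _)]
    refine CoeffLE.tsum ((summable_mul_exactGF _ _).mul_left _) (summable_mul_exactGF_add _ 1 _)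
      fun r => ?_
    rw [mul_left_comm, show r + (d + 1) = r + 1 + d by ring]
    exact (X_mul_exactGF_le B r).mul_left (coeffLE_zero_boundGF _ _)
  rw [boundExact_eq_add d]
  simpa using (coeffLE_zero_boundGF A d).add h

/-- Two splittings of the sums that have the same total. -/
lemma exactBound_one_add_boundExact_zero (A B : ℕ) :
    exactBound 1 A B + boundExact 0 A B = exactBound 2 A B + boundExact 1 A B := by
  have hs := summable_exactGF_mul (fun r => exactGF B r) 1 A
  have h₁ : exactBound 1 A B = exactBound 2 A B + ∑' r, exactGF A (r + 1) * exactGF B r := by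
    rw [exactBound_eq_add, exactBound, hs.tsum_eq_zero_add]
    rw [add_left_comm, ← Summable.tsum_add (summable_exactGF_mul _ _ _)
      (by simpa only [add_assoc] using
        summable_exactGF_mul (fun r => exactGF B (r + 1)) 2 A)]
    simp only [exactGF_zero_right, mul_one, zero_add]
    congr 1
    refine tsum_congr fun r => ?_
    rw [boundGF_succ_right, show r + 1 + 1 = r + 2 by ring]
    ring
  have h₂ : boundExact 1 A B = boundExact 0 A B + ∑' r, exactGF A (r + 1) * exactGF B r := by
    rw [boundExact, boundExact, ← Summable.tsum_add (summable_mul_exactGF _ _) hs]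
    refine tsum_congr fun r => ?_
    rw [boundGF_succ_right]
    simp only [add_zero]
    ring
  rw [h₁, h₂]
  ring

lemma exactBound_two_add_boundExact_one (A B : ℕ) :
    exactBound 2 A B + boundExact 1 A B = partGF A * partGF B := by
  induction A with
  | zero =>
    induction B with
    | zero =>
      rw [← exactBound_one_add_boundExact_zero, exactBound_eq_add, boundExact_eq_add]
      simp
    | succ B ih =>
      refine mul_left_cancel₀ (one_sub_X_pow_ne_zero B) ?_
      have h := one_sub_X_pow_mul_partGF B
      have h₁ := exactBound_succ_right 1 0 B
      have h₂ := boundExact_succ_right 0 0 B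
      have h₃ := exactBound_one_add_boundExact_zero 0 B
      have h₄ := exactBound_one_add_boundExact_zero 0 (B + 1)
      linear_combination -partGF 0 * h + ih - h₄ + h₃ + h₁ + h₂
  | succ A ih =>
    refine mul_left_cancel₀ (one_sub_X_pow_ne_zero A) ?_
    have h := one_sub_X_pow_mul_partGF A
    have h₁ := exactBound_succ_left 1 A B
    have h₂ := boundExact_succ_left 0 A B
    have h₄ := exactBound_one_add_boundExact_zero (A + 1) B
    linear_combination -partGF B * h + ih + h₁ + h₂ + X ^ (A + 1) * h₄

lemma exactBound_zero_zero_right (A : ℕ) : exactBound 0 A 0 = partGF A := by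
  have h := exactBound_two_add_boundExact_one A 0
  rw [← exactBound_one_add_boundExact_zero, boundExact_eq_add, exactBound] at h
  rw [exactBound_eq_add]
  simpa [add_comm] using h

lemma X_mul_X_mul_boundExact_one_le (A B : ℕ) :
    CoeffLE (X * (X * boundExact 1 A (B + 1))) (boundExact 0 A (B + 1)) :=
  ((X_mul_boundExact_succ_le 0 A B).mul_left (by simpa using coeffLE_zero_X_pow 1)).trans
    (((boundExact_le_succ 0 A (B + 1)).mul_left (by simpa using coeffLE_zero_X_pow 1)).trans
      (X_mul_boundExact_succ_le 0 A B))

lemma X_mul_X_mul_boundExact_zero_le (A B : ℕ) :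
    CoeffLE (X * (X * boundExact 0 A (B + 1))) (boundExactShift A (B + 1)) :=
  ((((boundExact_le_succ 0 A (B + 1)).mul_left (by simpa using coeffLE_zero_X_pow 1)).trans
      (X_mul_boundExact_succ_le 0 A B)).mul_left (by simpa using coeffLE_zero_X_pow 1)).trans
    (X_mul_boundExact_zero_le A B)

/-- A summand in the upper bound for the partitions whose rank exceeds `-k`. -/
noncomputable def rankTerm (k J : ℕ) : ℤ⟦X⟧ :=
  X ^ ((J + 1) * (J + k)) * exactBound 0 (k + J) (J + 1)

/-- A summand in the lower bound for the partitions whose crank exceeds `-(k + 1)`. -/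
noncomputable def crankTerm (k I : ℕ) : ℤ⟦X⟧ :=
  X ^ ((I + 1) * (I + k + 2)) * (partGF (k + I + 1) * partGF (I + 1))

/-- The part of `rankTerm` and of `crankTerm` that cancels directly. -/
noncomputable def commonTerm (k J : ℕ) : ℤ⟦X⟧ :=
  X ^ ((J + 1) * (J + k + 2)) * exactBound 2 (k + J) (J + 1)

/-- The part of `crankTerm` that cancels against the next `rankTerm`. -/
noncomputable def shiftedTerm (k I : ℕ) : ℤ⟦X⟧ :=
  X ^ ((I + 2) * (I + k + 1) + I + 1) * exactBound 1 (k + I + 1) (I + 1)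

/-- The part of `crankTerm` left after the cancellations. -/
noncomputable def restTerm (k I : ℕ) : ℤ⟦X⟧ :=
  X ^ ((I + 1) * (I + k + 2)) * boundExact 1 (k + I + 1) (I + 1)

/-- The part of `rankTerm` with the smallest power of `X`. -/
noncomputable def lowTerm (k J : ℕ) : ℤ⟦X⟧ :=
  X ^ ((J + 1) * (J + k)) * exactBound 0 (k + J) J

/-- The part of `lowTerm` that is compared with `restTerm` two steps earlier. -/
noncomputable def lowEarly (k : ℕ) : ℕ → ℤ⟦X⟧
  | 0 => X ^ (2 * (k + 1)) * exactBound 0 (k + 1) 0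
  | I + 1 => X ^ ((I + 3) * (I + k + 2) + I + 1) * exactBound 1 (k + I + 2) (I + 1)

/-- The part of `lowTerm` that is compared with `restTerm` three steps earlier. -/
noncomputable def lowLate (k : ℕ) : ℕ → ℤ⟦X⟧
  | 0 => 0
  | I + 1 => X ^ ((I + 3) * (I + k + 2)) * exactBound 0 (k + I + 2) I

/-- The part of `rankTerm` with middle power of `X` compared with `restTerm` of the same index. -/
noncomputable def midEarly (k : ℕ) : ℕ → ℤ⟦X⟧
  | 0 => X ^ (k + 1) * exactBound 1 k 0
  | I + 1 => X ^ ((I + 2) * (I + k + 2) + I + 1) * exactBound 2 (k + I + 1) (I + 1)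

/-- The part of `rankTerm` with middle power of `X` compared with the previous `restTerm`. -/
noncomputable def midLate (k : ℕ) : ℕ → ℤ⟦X⟧
  | 0 => 0
  | I + 1 => X ^ ((I + 2) * (I + k + 2)) * exactBound 1 (k + I + 1) I

lemma rankTerm_eq (k J : ℕ) :
    rankTerm k J = commonTerm k J + midEarly k J + midLate k J + lowTerm k J := by
  have h₀ := exactBound_succ_right 0 (k + J) J
  have h₁ := exactBound_succ_right 1 (k + J) J
  rw [rankTerm, commonTerm, lowTerm, h₀, h₁]
  rcases J with _ | I
  · simp only [midEarly, midLate, add_zero]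
    ring
  · have h₂ := exactBound_succ_right 1 (k + (I + 1)) I
    rw [midEarly, midLate, h₂, show k + (I + 1) = k + I + 1 by ring]
    ring

lemma lowTerm_succ (k I : ℕ) :
    lowTerm k (I + 1) = shiftedTerm k I + lowEarly k I + lowLate k I := by
  have h₀ := exactBound_succ_right 0 (k + (I + 1)) I
  rw [lowTerm, shiftedTerm, h₀, ← add_assoc k]
  rcases I with _ | I
  · simp only [lowEarly, lowLate, add_zero]
    ring
  · have h₂ := exactBound_succ_right 0 (k + (I + 1) + 1) I
    rw [lowEarly, lowLate, h₂, show k + (I + 1) + 1 = k + I + 2 by ring]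
    ring

lemma crankTerm_eq (k I : ℕ) :
    crankTerm k I = commonTerm k I + shiftedTerm k I + restTerm k I := by
  rw [crankTerm, commonTerm, shiftedTerm, restTerm, ← exactBound_two_add_boundExact_one,
    exactBound_succ_left 1]
  ring

lemma le_restTerm (k I : ℕ) :
    CoeffLE (midEarly k I + midLate k (I + 1) + lowEarly k I + lowLate k (I + 1))
      (restTerm k I) := by
  have hX := coeffLE_zero_X_pow
  rcases I with _ | I
  · have h₂ := (X_mul_X_mul_boundExact_one_le k 0).mul_left (hX (2 * k + 3))
    have h₃ := (X_mul_X_mul_boundExact_zero_le (k + 1) 0).mul_left (hX (3 * k + 4))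
    have hg : restTerm k 0 = X ^ (k + 2) * boundExact 1 k 1 +
        X ^ (2 * k + 3) * boundExact 0 k 1 +
        X ^ (3 * k + 4) * boundExactShift (k + 1) 1 := by
      rw [restTerm]
      simp only [add_zero, zero_add]
      rw [boundExact_succ_left 0 k, boundExact_zero_succ_left]
      ring
    have hml : midLate k 1 = X ^ (2 * k + 3) * (X * (X * boundExact 1 k 1)) := by
      rw [midLate]
      simp only [add_zero, zero_add]
      rw [exactBound_succ_eq_boundExact]
      ring
    have hll : lowLate k 1 = X ^ (3 * k + 4) * (X * (X * boundExact 0 (k + 1) 1)) := by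
      rw [lowLate]
      simp only [add_zero, zero_add]
      rw [exactBound_succ_eq_boundExact]
      ring
    have h₁ : CoeffLE (midEarly k 0 + lowEarly k 0) (X ^ (k + 2) * boundExact 1 k 1) := by
      rw [midEarly, lowEarly, exactBound_succ_eq_boundExact 0]
      rcases k with _ | k
      · have : exactBound 1 0 0 = 0 := by simp [exactBound]
        rw [this]
        simpa using (boundExact_le_succ 0 0 1).mul_left (hX 2)
      · rw [exactBound_succ_eq_boundExact, boundExact_succ_left 0 k]
        convert CoeffLE.refl _ using 1
        ring
    have h := (h₁.add h₂).add h₃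
    rw [hg, hml, hll]
    convert h using 1
    ring
  · have h₁ := (X_mul_boundExact_succ_le 1 (k + I) (I + 1)).mul_left (hX ((I + 2) * (I + k + 3)))
    have h₂ := (X_mul_X_mul_boundExact_one_le (k + I + 1) (I + 1)).mul_left
      (hX ((I + 2) * (I + k + 3) + (k + I + 2)))
    have h₃ := (X_mul_boundExact_succ_le 0 (k + I + 1) (I + 1)).mul_left
      (hX ((I + 2) * (I + k + 3) + (k + I + 1)))
    have h₄ := (X_mul_X_mul_boundExact_zero_le (k + I + 2) (I + 1)).mul_left
      (hX ((I + 2) * (I + k + 3) + 2 * (k + I + 2)))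
    convert ((h₁.add h₂).add h₃).add h₄ using 1
    · simp only [midEarly, midLate, lowEarly, lowLate]
      rw [exactBound_succ_eq_boundExact 2, exactBound_succ_eq_boundExact 0,
        show k + (I + 1) + 1 = k + I + 1 + 1 by ring,
        show k + I + 2 = k + I + 1 + 1 by ring, exactBound_succ_eq_boundExact 1]
      ring
    · rw [restTerm, show k + (I + 1) + 1 = k + I + 1 + 1 by ring, boundExact_succ_left 0,
        boundExact_zero_succ_left, boundExact_succ_left 0]
      ring

lemma coeffLE_zero_lowTerm (k J : ℕ) : CoeffLE 0 (lowTerm k J) :=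
  (coeffLE_zero_X_pow _).zero_mul (coeffLE_zero_exactBound _ _ _)

lemma coeffLE_zero_lowLate (k : ℕ) : ∀ J, CoeffLE 0 (lowLate k J)
  | 0 => CoeffLE.refl 0
  | _ + 1 => (coeffLE_zero_X_pow _).zero_mul (coeffLE_zero_exactBound _ _ _)

lemma coeffLE_zero_midLate (k : ℕ) : ∀ J, CoeffLE 0 (midLate k J)
  | 0 => CoeffLE.refl 0
  | _ + 1 => (coeffLE_zero_X_pow _).zero_mul (coeffLE_zero_exactBound _ _ _)

lemma sum_rankTerm_add_le (k K : ℕ) :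
    CoeffLE ((1 - X ^ k) * partGF k + ∑ J ∈ Finset.range K, rankTerm k J +
        (midLate k K + lowTerm k K + lowLate k K))
      (partGF k + ∑ I ∈ Finset.range K, crankTerm k I) := by
  induction K with
  | zero =>
    convert CoeffLE.refl _ using 1
    simp only [Finset.range_zero, Finset.sum_empty, midLate, lowTerm, lowLate, add_zero, zero_add,
      one_mul, exactBound_zero_zero_right]
    ring
  | succ K ih =>
    convert (ih.add (CoeffLE.refl (commonTerm k K + shiftedTerm k K))).add (le_restTerm k K)
      using 1
    · rw [Finset.sum_range_succ, rankTerm_eq, lowTerm_succ]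
      ring
    · rw [Finset.sum_range_succ, crankTerm_eq]
      ring

lemma sum_rankTerm_le (k K : ℕ) :
    CoeffLE ((1 - X ^ k) * partGF k + ∑ J ∈ Finset.range K, rankTerm k J)
      (partGF k + ∑ I ∈ Finset.range K, crankTerm k I) := by
  refine CoeffLE.trans ?_ (sum_rankTerm_add_le k K)
  simpa using (CoeffLE.refl ((1 - X ^ k) * partGF k + ∑ J ∈ Finset.range K, rankTerm k J)).add
    (((coeffLE_zero_midLate k K).zero_add (coeffLE_zero_lowTerm k K)).zero_add
      (coeffLE_zero_lowLate k K))

lemma CoeffLE.sum {ι : Type*} {s : Finset ι} {f g : ι → ℤ⟦X⟧}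
    (h : ∀ i ∈ s, CoeffLE (f i) (g i)) : CoeffLE (∑ i ∈ s, f i) (∑ i ∈ s, g i) := fun n => by
  simpa only [map_sum] using Finset.sum_le_sum fun i hi => h i hi n

/-- The generating function of the partitions with largest part `i + 1` and at most `i + k`
parts. -/
noncomputable def rankBlock (k i : ℕ) : ℤ⟦X⟧ := X ^ (i + 1) * gaussBinom (2 * i + k) (i + 1)

lemma coeffLE_zero_exactGF_mul_boundGF (A B r : ℕ) :
    CoeffLE 0 (exactGF A r * boundGF B r) :=
  (coeffLE_zero_exactGF _ _).zero_mul (coeffLE_zero_boundGF _ _)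

lemma rankBlock_le (k i : ℕ) :
    CoeffLE (rankBlock k i) (X ^ (i + 1) * gaussBinom (i + k - 1) (i + 1) +
      ∑ J ∈ Finset.range (i + 1), X ^ ((J + 1) * (J + k)) *
        (exactGF (k + J) (i - J) * boundGF (J + 1) (i - J))) := by
  rcases Nat.eq_zero_or_pos (i + k) with h | h
  · obtain ⟨rfl, rfl⟩ : i = 0 ∧ k = 0 := by omega
    simpa [rankBlock, gaussBinom_eq_zero_of_lt] using coeffLE_zero_X_pow 0
  obtain ⟨M, hM⟩ : ∃ M, i + k = M + 1 := ⟨i + k - 1, by omega⟩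
  convert CoeffLE.refl _ using 1
  rw [rankBlock, show 2 * i + k = M + (i + 1) by omega, gaussBinom_add,
    ← Finset.Nat.sum_antidiagonal_swap, Finset.Nat.sum_antidiagonal_eq_sum_range_succ_mk,
    Finset.sum_range_succ' _ (i + 1), mul_add, Finset.mul_sum, add_comm (Finset.sum _ _)]
  congr 1
  · simp [hM]
  · refine Finset.sum_congr rfl fun J hJ => ?_
    obtain ⟨x, rfl⟩ : ∃ x, i = J + x := ⟨i - J, by simp at hJ; omega⟩
    have e : J + x + 1 - (J + 1) = x := by omega
    simp only [Prod.swap_prod_mk, e, Nat.add_sub_cancel_left, exactGF, boundGF]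
    rw [show J + x + 1 = (J + 1) + x by ring, gaussBinom_symm (J + 1) x,
      show k + J + x - 1 = M by omega]
    rcases lt_or_ge M x with hx | hx
    · simp [gaussBinom_eq_zero_of_lt hx]
    · have : J + k = M - x + 1 := by omega
      rw [this]
      ring

lemma sum_exactGF_le (k K : ℕ) :
    CoeffLE (∑ i ∈ Finset.range K, X ^ (i + 1) * gaussBinom (i + k - 1) (i + 1))
      ((1 - X ^ k) * partGF k) := by
  rcases k with _ | k
  · rw [Finset.sum_eq_zero]
    · simpa using CoeffLE.refl 0
    · intro i _
      rw [gaussBinom_eq_zero_of_lt (by omega), mul_zero]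
  · rw [one_sub_X_pow_mul_partGF, ← exactBound_zero_zero_right]
    refine CoeffLE.trans ?_ (CoeffLE.sum_le_tsum (summable_exactGF_mul _ 0 k)
      (fun r => coeffLE_zero_exactGF_mul_boundGF _ _ _) (K + 1))
    rw [Finset.sum_range_succ']
    have h : ∑ i ∈ Finset.range K, X ^ (i + 1) * gaussBinom (i + (k + 1) - 1) (i + 1) =
        ∑ i ∈ Finset.range K, exactGF k (i + 1 + 0) * boundGF 0 (i + 1) :=
      Finset.sum_congr rfl fun i _ => by
        rw [boundGF_zero_left, mul_one, exactGF]
        congr 2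
        omega
    rw [h]
    simpa using (CoeffLE.refl (∑ i ∈ Finset.range K, exactGF k (i + 1))).add
      (coeffLE_zero_X_pow 0)

lemma sum_rankBlock_le (k K : ℕ) :
    CoeffLE (∑ i ∈ Finset.range K, rankBlock k i)
      (partGF k + ∑ I ∈ Finset.range K, crankTerm k I) := by
  refine CoeffLE.trans (CoeffLE.sum fun i _ => rankBlock_le k i) ?_
  rw [Finset.sum_add_distrib]
  refine CoeffLE.trans ((sum_exactGF_le k K).add ?_) (sum_rankTerm_le k K)
  rw [Finset.sum_comm' (t' := Finset.range K) (s' := fun J => Finset.Ico J K)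
    (by intro i J; simp only [Finset.mem_range, Finset.mem_Ico]; omega)]
  refine CoeffLE.sum fun J _ => ?_
  rw [Finset.sum_Ico_eq_sum_range, rankTerm, ← Finset.mul_sum]
  simp only [Nat.add_sub_cancel_left]
  exact (CoeffLE.sum_le_tsum (summable_exactGF_mul _ 0 _)
    (fun r => coeffLE_zero_exactGF_mul_boundGF _ _ _) _).mul_left (coeffLE_zero_X_pow _)

/-- The generating function of the partitions with exactly `i` parts larger than `w`. -/
noncomputable def largeGF (w i : ℕ) : ℤ⟦X⟧ := X ^ (i * (w + 1)) * (partGF i * partGF w)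

/-- The generating function of the partitions with at most `j` parts larger than `w`. -/
noncomputable def atMostLargeGF (w j : ℕ) : ℤ⟦X⟧ := ∑ i ∈ Finset.range (j + 1), largeGF w i

lemma atMostLargeGF_zero_right (w : ℕ) : atMostLargeGF w 0 = partGF w := by
  simp [atMostLargeGF, largeGF]

lemma atMostLargeGF_succ_succ (w j : ℕ) :
    atMostLargeGF (w + 1) (j + 1) =
      atMostLargeGF w j + X ^ ((j + 1) * (w + 1)) * (partGF (j + 1) * partGF (w + 1)) := by
  have hw := one_sub_X_pow_mul_partGF w
  induction j with
  | zero =>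
    have h := one_sub_X_pow_mul_partGF 0
    simp only [atMostLargeGF, Finset.sum_range_succ, Finset.sum_range_zero, largeGF]
    simp only [partGF_zero] at *
    linear_combination hw - X ^ (w + 1) * partGF (w + 1) * h
  | succ j ih =>
    have h := one_sub_X_pow_mul_partGF (j + 1)
    rw [atMostLargeGF, Finset.sum_range_succ, ← atMostLargeGF, ih, atMostLargeGF.eq_1 w (j + 1),
      Finset.sum_range_succ _ (j + 1), ← atMostLargeGF, largeGF, largeGF]
    linear_combination X ^ ((j + 1) * (w + 1)) * partGF (j + 1) * hw -
      X ^ ((j + 2) * (w + 1)) * partGF (w + 1) * h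

/-- The generating function of the partitions with exactly `i + k + 1` parts equal to one and at
most `i` parts larger than `i + k + 1`. -/
noncomputable def crankBlock (k i : ℕ) : ℤ⟦X⟧ :=
  X ^ (i + k + 1) * ((1 - X) * atMostLargeGF (i + k + 1) i)

lemma sum_crankBlock_add (k K : ℕ) :
    ∑ i ∈ Finset.range (K + 1), crankBlock k i +
        X ^ (K + k + 2) * atMostLargeGF (K + k + 1) K +
        (partGF k + ∑ I ∈ Finset.range (K + 1), crankTerm k I) =
      atMostLargeGF (K + k + 1) (K + 1) := by
  induction K with
  | zero =>
    have h := one_sub_X_pow_mul_partGF 0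
    have h' := atMostLargeGF_succ_succ (0 + k) 0
    rw [h', Finset.sum_range_one, Finset.sum_range_one, crankBlock, crankTerm,
      atMostLargeGF_zero_right, atMostLargeGF_zero_right]
    simp only [zero_add, add_zero, partGF_zero] at *
    linear_combination -X ^ (k + 1) * partGF (k + 1) * h
  | succ K ih =>
    have h := one_sub_X_pow_mul_partGF (K + 1)
    rw [show K + 1 + k + 1 = (K + k + 1) + 1 by ring, atMostLargeGF_succ_succ (K + k + 1) (K + 1),
      ← ih, Finset.sum_range_succ _ (K + 1), Finset.sum_range_succ _ (K + 1), crankBlock,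
      crankTerm, show K + 1 + k + 1 = (K + k + 1) + 1 by ring,
      show k + (K + 1) + 1 = K + k + 1 + 1 by ring, atMostLargeGF_succ_succ (K + k + 1) K]
    linear_combination -X ^ ((K + 2) * (K + k + 2)) * partGF (K + k + 2) * h

lemma sum_crankBlock_add_sum_rankBlock_le (k K : ℕ)
    (h : CoeffLE 0 (atMostLargeGF (K + k + 1) K)) :
    CoeffLE (∑ i ∈ Finset.range (K + 1), crankBlock k i +
      ∑ i ∈ Finset.range (K + 1), rankBlock k i) (atMostLargeGF (K + k + 1) (K + 1)) := by
  rw [← sum_crankBlock_add, add_assoc]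
  refine (CoeffLE.refl _).add ?_
  simpa using ((coeffLE_zero_X_pow (K + k + 2)).zero_mul h).add (sum_rankBlock_le k (K + 1))

/-- The finite set of partitions of `n`, viewed as multisets, that satisfy `P`. -/
def partitionSet (P : Multiset ℕ → Prop) (n : ℕ) : Set (Multiset ℕ) :=
  {s | 0 ∉ s ∧ s.sum = n ∧ P s}

lemma partitionSet_eq_image (P : Multiset ℕ → Prop) (n : ℕ) :
    partitionSet P n = Nat.Partition.parts '' {l : n.Partition | P l.parts} := by
  ext s
  constructor
  · rintro ⟨h₀, rfl, hP⟩
    exact ⟨⟨s, fun {i} hi => Nat.pos_of_ne_zero fun h => h₀ (h ▸ hi), rfl⟩, hP, rfl⟩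
  · rintro ⟨l, hl, rfl⟩
    exact ⟨fun h => (l.parts_pos h).ne rfl, l.parts_sum, hl⟩

lemma finite_partitionSet (P : Multiset ℕ → Prop) (n : ℕ) : (partitionSet P n).Finite := by
  rw [partitionSet_eq_image]
  exact (Set.toFinite _).image _

/-- The generating function of the partitions that satisfy `P`. -/
noncomputable def multisetGF (P : Multiset ℕ → Prop) : ℤ⟦X⟧ :=
  PowerSeries.mk fun n => ((partitionSet P n).ncard : ℤ)

lemma coeff_multisetGF (P : Multiset ℕ → Prop) (n : ℕ) :
    coeff n (multisetGF P) = Nat.card {l : n.Partition // P l.parts} := by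
  rw [multisetGF, coeff_mk, partitionSet_eq_image,
    Set.ncard_image_of_injective _ fun _ _ => Nat.Partition.ext]
  rfl

lemma multisetGF_congr {P Q : Multiset ℕ → Prop} (h : ∀ s, 0 ∉ s → (P s ↔ Q s)) :
    multisetGF P = multisetGF Q := by
  have : partitionSet P = partitionSet Q := by
    ext n s
    exact and_congr_right fun h₀ => and_congr_right fun _ => h s h₀
  rw [multisetGF, this, multisetGF]

lemma coeffLE_zero_multisetGF (P : Multiset ℕ → Prop) : CoeffLE 0 (multisetGF P) := fun n => by
  simp [multisetGF]

lemma multisetGF_split (P R : Multiset ℕ → Prop) :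
    multisetGF P = multisetGF (fun s => P s ∧ R s) + multisetGF (fun s => P s ∧ ¬ R s) := by
  ext n
  simp only [multisetGF, coeff_mk, map_add]
  rw [← Set.ncard_inter_add_ncard_sdiff_eq_ncard _ {s | R s} (finite_partitionSet P n),
    Nat.cast_add]
  congr 3 <;> ext s <;> simp [partitionSet, and_assoc]

lemma multisetGF_eq_sum (P : Multiset ℕ → Prop) (g : Multiset ℕ → ℕ) (K : ℕ) :
    multisetGF (fun s => P s ∧ g s < K) =
      ∑ i ∈ Finset.range K, multisetGF fun s => P s ∧ g s = i := by
  induction K with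
  | zero =>
    ext n
    simp [multisetGF, partitionSet]
  | succ K ih =>
    rw [Finset.sum_range_succ, ← ih, multisetGF_split _ fun s => g s < K]
    congr 1 <;> refine multisetGF_congr fun s _ => ?_
    · rw [and_assoc]
      exact and_congr_right fun _ => by omega
    · rw [and_assoc]
      exact and_congr_right fun _ => by omega

lemma multisetGF_eq_of_bijOn {P Q : Multiset ℕ → Prop} {f : Multiset ℕ → Multiset ℕ} {d : ℕ}
    (hf : Set.BijOn f {s | 0 ∉ s ∧ P s} {s | 0 ∉ s ∧ Q s})
    (hd : ∀ s, P s → (f s).sum = s.sum + d) : multisetGF Q = X ^ d * multisetGF P := by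
  ext n
  rw [coeff_X_pow_mul', multisetGF, coeff_mk]
  split_ifs with h
  · have hinj : Set.InjOn f (partitionSet P (n - d)) := by
      refine hf.injOn.mono ?_
      rintro s ⟨h₀, -, hP⟩
      exact ⟨h₀, hP⟩
    rw [multisetGF, coeff_mk, ← hinj.ncard_image]
    congr 2
    ext s
    constructor
    · rintro ⟨h₀, hs, hQ⟩
      obtain ⟨t, ⟨ht₀, hP⟩, rfl⟩ := hf.surjOn ⟨h₀, hQ⟩
      have := hd t hP
      exact ⟨t, ⟨ht₀, by omega, hP⟩, rfl⟩
    · rintro ⟨t, ⟨ht₀, ht, hP⟩, rfl⟩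
      have := hd t hP
      exact ⟨(hf.mapsTo ⟨ht₀, hP⟩).1, by omega, (hf.mapsTo ⟨ht₀, hP⟩).2⟩
  · rw [Nat.cast_eq_zero, Set.ncard_eq_zero (finite_partitionSet Q n),
      Set.eq_empty_iff_forall_notMem]
    rintro s ⟨h₀, hs, hQ⟩
    obtain ⟨t, ⟨ht₀, hP⟩, rfl⟩ := hf.surjOn ⟨h₀, hQ⟩
    have := hd t hP
    omega

lemma multisetGF_mem {v : ℕ} (hv : v ≠ 0) (P : Multiset ℕ → Prop) :
    multisetGF (fun s => v ∈ s ∧ P s) = X ^ v * multisetGF fun s => P (v ::ₘ s) := by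
  refine multisetGF_eq_of_bijOn (f := fun s => v ::ₘ s) ⟨?_, ?_, ?_⟩ ?_
  · rintro s ⟨h₀, hP⟩
    exact ⟨by simp [h₀, hv.symm], by simp, hP⟩
  · intro s _ t _ h
    simpa using h
  · rintro s ⟨h₀, hs, hP⟩
    refine ⟨s.erase v, ⟨fun h => h₀ (Multiset.mem_of_mem_erase h), ?_⟩, Multiset.cons_erase hs⟩
    rwa [Multiset.cons_erase hs]
  · intro s _
    simp [add_comm]

lemma multisetGF_split_mem {v : ℕ} (hv : v ≠ 0) (P : Multiset ℕ → Prop) :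
    multisetGF P =
      X ^ v * multisetGF (fun s => P (v ::ₘ s)) + multisetGF (fun s => v ∉ s ∧ P s) := by
  rw [multisetGF_split P fun s => v ∈ s, ← multisetGF_mem hv]
  simp only [and_comm]

lemma multisetGF_eq_one {P : Multiset ℕ → Prop} (h : ∀ s, 0 ∉ s → (P s ↔ s = 0)) :
    multisetGF P = 1 := by
  rw [multisetGF_congr h]
  ext n
  rw [multisetGF, coeff_mk, coeff_one]
  split_ifs with hn
  · rw [show partitionSet (fun s => s = 0) n = {0} by
      ext s
      simp only [partitionSet, Set.mem_ofPred_eq, Set.mem_singleton_iff]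
      exact ⟨fun h => h.2.2, fun h => by simp [h, hn]⟩]
    simp
  · rw [show partitionSet (fun s => s = 0) n = ∅ by
      ext s
      simp only [partitionSet, Set.mem_ofPred_eq, Set.mem_empty_iff_false, iff_false]
      rintro ⟨-, hs, rfl⟩
      exact hn hs.symm]
    simp

lemma multisetGF_box (L W : ℕ) :
    multisetGF (fun s => s.card ≤ L ∧ ∀ x ∈ s, x ≤ W) = gaussBinom (L + W) W := by
  induction W generalizing L with
  | zero =>
    rw [gaussBinom_zero_right]
    refine multisetGF_eq_one fun s h₀ => ⟨fun h => ?_, fun h => by simp [h]⟩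
    refine Multiset.eq_zero_of_forall_notMem fun x hx => h₀ ?_
    rwa [← Nat.le_zero.1 (h.2 x hx)]
  | succ W ihW =>
    induction L with
    | zero =>
      rw [zero_add, gaussBinom_self]
      refine multisetGF_eq_one fun s h₀ => ⟨fun h => by simpa using h.1, fun h => by simp [h]⟩
    | succ L ihL =>
      rw [multisetGF_split_mem (Nat.add_one_ne_zero W), ← add_assoc, gaussBinom_succ_succ,
        add_right_comm L 1 W, add_right_comm L W 1, ← ihW, add_right_comm L 1 W, add_assoc L W 1,
        ← ihL, add_comm]
      congr 1
      · refine multisetGF_congr fun s _ => ⟨fun h => ⟨h.2.1, fun x hx => ?_⟩, fun h => ?_⟩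
        · have := h.2.2 x hx
          have : x ≠ W + 1 := fun e => h.1 (e ▸ hx)
          omega
        · exact ⟨fun hW => by have := h.2 _ hW; omega, h.1, fun x hx => (h.2 x hx).trans (by omega)⟩
      · congr 1
        exact multisetGF_congr fun s _ => by simp

lemma multisetGF_rankBlock (k i : ℕ) :
    multisetGF (fun s => i + 1 ∈ s ∧ s.card ≤ i + k ∧ ∀ x ∈ s, x ≤ i + 1) = rankBlock k i := by
  rw [multisetGF_mem (Nat.succ_ne_zero i), rankBlock]
  congr 1
  rcases Nat.eq_zero_or_pos (i + k) with h | h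
  · rw [gaussBinom_eq_zero_of_lt (by omega)]
    ext n
    simp [multisetGF, partitionSet, h]
  · rw [show 2 * i + k = (i + k - 1) + (i + 1) by omega, ← multisetGF_box]
    refine multisetGF_congr fun s _ => ?_
    simp only [Multiset.card_cons, Multiset.mem_cons, forall_eq_or_imp, le_refl, true_and]
    exact and_congr_left fun _ => by omega

/-- The map that increases by one the parts larger than `w`. -/
def shiftLarge (w : ℕ) (s : Multiset ℕ) : Multiset ℕ := s.map fun x => if w < x then x + 1 else x

lemma sum_shiftLarge (w : ℕ) (s : Multiset ℕ) :
    (shiftLarge w s).sum = s.sum + s.countP (w < ·) := by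
  induction s using Multiset.induction_on with
  | empty => simp [shiftLarge]
  | cons a s ih =>
    simp only [shiftLarge, Multiset.map_cons, Multiset.sum_cons, Multiset.countP_cons] at ih ⊢
    split_ifs <;> omega

lemma multisetGF_shiftLarge (w i : ℕ) :
    multisetGF (fun s => w + 1 ∉ s ∧ s.countP (w < ·) = i) =
      X ^ i * multisetGF (fun s => s.countP (w < ·) = i) := by
  refine multisetGF_eq_of_bijOn (f := shiftLarge w)
    (Set.InvOn.bijOn (f' := fun s => s.map fun x => if w < x then x - 1 else x) ⟨?_, ?_⟩ ?_ ?_) ?_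
  · intro s _
    simp only [shiftLarge, Multiset.map_map, Function.comp_def]
    refine (Multiset.map_congr rfl fun x _ => ?_).trans (Multiset.map_id s)
    simp only [id]
    split_ifs <;> omega
  · rintro s ⟨h₀, hw, -⟩
    simp only [shiftLarge, Multiset.map_map, Function.comp_def]
    refine (Multiset.map_congr rfl fun x hx => ?_).trans (Multiset.map_id s)
    have : x ≠ w + 1 := fun e => hw (e ▸ hx)
    simp only [id]
    split_ifs <;> omega
  · rintro s ⟨h₀, hs⟩
    refine ⟨?_, ?_, ?_⟩
    · simp only [shiftLarge, Multiset.mem_map, not_exists, not_and]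
      intro x hx h
      have : x ≠ 0 := fun e => h₀ (e ▸ hx)
      split_ifs at h
      omega
    · simp only [shiftLarge, Multiset.mem_map, not_exists, not_and]
      intro x hx h
      split_ifs at h <;> omega
    · rw [← hs, shiftLarge, Multiset.countP_map, Multiset.countP_eq_card_filter]
      refine congrArg _ ?_
      refine Multiset.filter_congr fun x _ => ?_
      split_ifs <;> omega
  · rintro s ⟨h₀, hw, hs⟩
    have hw' : ∀ x ∈ s, x ≠ w + 1 := fun x hx e => hw (e ▸ hx)
    refine ⟨?_, ?_⟩
    · simp only [Multiset.mem_map, not_exists, not_and]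
      intro x hx h
      have : x ≠ 0 := fun e => h₀ (e ▸ hx)
      have := hw' x hx
      split_ifs at h <;> omega
    · rw [← hs]
      refine (Multiset.countP_map _ _ _).trans ?_
      rw [Multiset.countP_eq_card_filter]
      congr 1
      refine Multiset.filter_congr fun x hx => ?_
      have := hw' x hx
      split_ifs <;> omega
  · intro s hs
    rw [sum_shiftLarge, hs]

lemma multisetGF_large (w i : ℕ) :
    multisetGF (fun s => s.countP (w < ·) = i) = largeGF w i := by
  induction w with
  | zero =>
    induction i with
    | zero =>
      rw [multisetGF_eq_one, largeGF]
      · simp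
      · intro s h₀
        rw [Multiset.countP_eq_zero]
        refine ⟨fun h => Multiset.eq_zero_of_forall_notMem fun x hx => h₀ ?_, fun h => by simp [h]⟩
        rwa [← Nat.eq_zero_of_not_pos (h x hx)]
    | succ i ih =>
      have h := multisetGF_split_mem one_ne_zero fun s => s.countP (0 < ·) = i + 1
      have h' := multisetGF_shiftLarge 0 (i + 1)
      have he := one_sub_X_pow_mul_partGF i
      simp only [Multiset.countP_cons, zero_lt_one, if_true, Nat.add_right_cancel_iff, zero_add]
        at h h'
      rw [h', ih] at h
      refine mul_left_cancel₀ (one_sub_X_pow_ne_zero i) ?_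
      simp only [largeGF, partGF_zero] at h ⊢
      linear_combination h - X ^ (i + 1) * he
  | succ w ih =>
    have h := multisetGF_split_mem (Nat.succ_ne_zero w) fun s => s.countP (w + 1 < ·) = i
    have h' : multisetGF (fun s => w + 1 ∉ s ∧ s.countP (w + 1 < ·) = i) =
        multisetGF (fun s => w + 1 ∉ s ∧ s.countP (w < ·) = i) :=
      multisetGF_congr fun s _ => and_congr_right fun hw => by
        refine Eq.congr_left (Multiset.countP_congr rfl fun x hx => ?_)
        have : x ≠ w + 1 := fun e => hw (e ▸ hx)
        simp only [eq_iff_iff]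
        omega
    have he := one_sub_X_pow_mul_partGF w
    rw [h', multisetGF_shiftLarge, ih] at h
    simp only [Nat.succ_eq_add_one, Multiset.countP_cons, lt_irrefl, if_false, add_zero] at h
    refine mul_left_cancel₀ (one_sub_X_pow_ne_zero w) ?_
    simp only [largeGF] at h ⊢
    linear_combination h - X ^ (i * (w + 2)) * partGF i * he

lemma multisetGF_atMostLarge (w j : ℕ) :
    multisetGF (fun s => s.countP (w < ·) ≤ j) = atMostLargeGF w j := by
  simpa [multisetGF_large, atMostLargeGF, Nat.lt_succ_iff] using
    multisetGF_eq_sum (fun _ => True) (fun s => s.countP (w < ·)) (j + 1)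

lemma multisetGF_count_one (c w j : ℕ) (hw : 1 ≤ w) :
    multisetGF (fun s => s.count 1 = c ∧ s.countP (w < ·) ≤ j) =
      X ^ c * ((1 - X) * atMostLargeGF w j) := by
  induction c with
  | zero =>
    have h := multisetGF_split_mem one_ne_zero fun s => s.countP (w < ·) ≤ j
    simp only [Multiset.countP_cons, if_neg (not_lt.2 hw), add_zero,
      multisetGF_atMostLarge] at h
    simp only [Multiset.count_eq_zero]
    linear_combination -h
  | succ c ih =>
    have h := multisetGF_mem one_ne_zero fun s => s.count 1 = c + 1 ∧ s.countP (w < ·) ≤ j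
    simp only [Multiset.countP_cons, if_neg (not_lt.2 hw), add_zero, Multiset.count_cons_self,
      Nat.add_right_cancel_iff, ih] at h
    rw [pow_one, ← mul_assoc, ← pow_succ'] at h
    rw [← h]
    refine multisetGF_congr fun s _ => ⟨fun h => ⟨?_, h⟩, fun h => h.2⟩
    rw [← Multiset.count_pos, h.1]
    omega

/-- The crank of `s` is at most `-(k + 1)`. -/
def SmallCrank (k : ℕ) (s : Multiset ℕ) : Prop :=
  k + 1 ≤ s.count 1 ∧ s.countP (s.count 1 < ·) + (k + 1) ≤ s.count 1

/-- The rank of `s` exceeds `-k`. -/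
def LargeRank (k : ℕ) (s : Multiset ℕ) : Prop :=
  ∃ m ∈ s, (∀ x ∈ s, x ≤ m) ∧ s.card < m + k

lemma multisetGF_smallCrank (k K : ℕ) :
    multisetGF (fun s => SmallCrank k s ∧ s.count 1 - (k + 1) < K) =
      ∑ i ∈ Finset.range K, crankBlock k i := by
  rw [multisetGF_eq_sum]
  refine Finset.sum_congr rfl fun i _ => ?_
  rw [crankBlock, ← multisetGF_count_one _ _ _ (by omega)]
  refine multisetGF_congr fun s _ => ⟨?_, ?_⟩
  · rintro ⟨⟨h₁, h₂⟩, h₃⟩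
    have h₄ : s.count 1 = i + k + 1 := by omega
    rw [h₄] at h₂
    exact ⟨h₄, by omega⟩
  · rintro ⟨h₁, h₂⟩
    rw [SmallCrank, h₁]
    omega

lemma multisetGF_largeRank (k K : ℕ) :
    multisetGF (fun s => LargeRank k s ∧ s.sup - 1 < K) =
      ∑ i ∈ Finset.range K, rankBlock k i := by
  have hsup : ∀ {s : Multiset ℕ} {m : ℕ}, m ∈ s → (∀ x ∈ s, x ≤ m) → s.sup = m :=
    fun hm h => le_antisymm (Multiset.sup_le.2 h) (Multiset.le_sup hm)
  rw [multisetGF_eq_sum]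
  refine Finset.sum_congr rfl fun i _ => ?_
  rw [← multisetGF_rankBlock]
  refine multisetGF_congr fun s h₀ => ⟨?_, ?_⟩
  · rintro ⟨⟨m, hm, h₁, h₂⟩, h₃⟩
    have h₄ : m ≠ 0 := fun e => h₀ (e ▸ hm)
    rw [hsup hm h₁] at h₃
    obtain rfl : m = i + 1 := by omega
    exact ⟨hm, by omega, h₁⟩
  · rintro ⟨hm, h₁, h₂⟩
    exact ⟨⟨i + 1, hm, h₂, by omega⟩, by rw [hsup hm h₂]; omega⟩

lemma sup_le_sum (s : Multiset ℕ) : s.sup ≤ s.sum :=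
  Multiset.sup_le.2 fun _ hx => Multiset.le_sum_of_mem hx

/-- Partitions with small crank and partitions with large rank together are not more numerous
than all partitions. -/
lemma card_smallCrank_add_card_largeRank_le (k n : ℕ) :
    Nat.card {l : n.Partition // SmallCrank k l.parts} +
      Nat.card {l : n.Partition // LargeRank k l.parts} ≤ Nat.card n.Partition := by
  have h := sum_crankBlock_add_sum_rankBlock_le k n
    (by rw [← multisetGF_atMostLarge]; exact coeffLE_zero_multisetGF _) n
  rw [← multisetGF_smallCrank, ← multisetGF_largeRank, ← multisetGF_atMostLarge, map_add,
    coeff_multisetGF, coeff_multisetGF, coeff_multisetGF, ← Nat.cast_add, Nat.cast_le] at h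
  have hc : ∀ l : n.Partition, l.parts.count 1 - (k + 1) < n + 1 := fun l => by
    have h₁ := Multiset.count_le_card 1 l.parts
    have h₂ := Multiset.card_nsmul_le_sum (s := l.parts) (a := 1) fun x hx => l.parts_pos hx
    rw [l.parts_sum, smul_eq_mul, mul_one] at h₂
    omega
  have hr : ∀ l : n.Partition, l.parts.sup - 1 < n + 1 := fun l => by
    have := sup_le_sum l.parts
    rw [l.parts_sum] at this
    omega
  simp only [hc, hr, and_true] at h
  exact h.trans (Nat.card_le_card_of_injective _ Subtype.val_injective)

end RankCrankSeries

namespace RankCrank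

lemma parts_eq_zero_or_part_one_mem {n : ℕ} (l : n.Partition) : (l.parts = 0 ∧ part l 1 = 0) ∨
    (part l 1 ∈ l.parts ∧ ∀ x ∈ l.parts, x ≤ part l 1) := by
  have hmem : ∀ x, x ∈ (l.parts.sort (· ≤ ·)).reverse ↔ x ∈ l.parts := by simp
  have hsort : (l.parts.sort (· ≤ ·)).reverse.Pairwise (· ≥ ·) := by
    rw [List.pairwise_reverse]
    exact l.parts.pairwise_sort (· ≤ ·)
  rw [part]
  generalize (l.parts.sort (· ≤ ·)).reverse = t at hmem hsort
  rcases t with _ | ⟨a, t⟩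
  · exact Or.inl ⟨Multiset.eq_zero_of_forall_notMem fun x hx => by simpa using (hmem x).2 hx, rfl⟩
  · refine Or.inr ⟨(hmem a).1 (by simp), fun x hx => ?_⟩
    rcases List.mem_cons.1 ((hmem x).2 hx) with rfl | h
    · exact le_rfl
    · exact (List.pairwise_cons.1 hsort).1 x h

lemma neg_le_rank {n : ℕ} (l : n.Partition) : -(n : ℤ) ≤ rank l := by
  have h := Multiset.card_nsmul_le_sum (s := l.parts) (a := 1) fun x hx => l.parts_pos hx
  rw [l.parts_sum, smul_eq_mul, mul_one] at h
  rw [rank]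
  omega

lemma smallCrank_of_crank_le {n k : ℕ} {l : n.Partition} (h : crank l ≤ -((k : ℤ) + 1)) :
    RankCrankSeries.SmallCrank k l.parts := by
  rw [crank] at h
  split_ifs at h
  · omega
  · rw [← Multiset.countP_eq_card_filter] at h
    constructor <;> omega

lemma rank_le_of_not_largeRank {n k : ℕ} (hn : 1 ≤ n) {l : n.Partition}
    (h : ¬ RankCrankSeries.LargeRank k l.parts) : rank l ≤ -(k : ℤ) := by
  by_contra hr
  rw [rank] at hr
  rcases parts_eq_zero_or_part_one_mem l with ⟨h₀, -⟩ | ⟨h₁, h₂⟩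
  · have := l.parts_sum
    rw [h₀, Multiset.sum_zero] at this
    omega
  · exact h ⟨part l 1, h₁, h₂, by omega⟩

lemma sum_card_fiber {α : Type*} [Finite α] (f : α → ℤ) (a b : ℤ) :
    ∑ r ∈ Finset.Icc a b, Nat.card {x // f x = r} = Nat.card {x // a ≤ f x ∧ f x ≤ b} := by
  classical
  have := Fintype.ofFinite α
  simp only [Nat.card_eq_fintype_card, Fintype.card_subtype]
  rw [Finset.card_eq_sum_card_fiberwise (f := f) (t := Finset.Icc a b)
    (fun x hx => by simpa using hx)]
  refine Finset.sum_congr rfl fun r hr => ?_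
  rw [Finset.filter_filter]
  congr 1
  refine Finset.filter_congr fun x _ => ⟨?_, fun h => h.2⟩
  rintro rfl
  exact ⟨by simpa using hr, rfl⟩

lemma M_le_card {r : ℤ} (hr : r < 0) (n : ℕ) :
    M r n ≤ Nat.card {l : n.Partition // crank l = r} := by
  rw [M]
  split_ifs with hn h₀ h₁
  · omega
  · subst hn
    obtain rfl : r = -1 := by omega
    have : Nonempty {l : Nat.Partition 1 // crank l = -1} :=
      ⟨Nat.Partition.indiscrete 1, by simp [crank]⟩
    exact Nat.one_le_cast.2 Nat.card_pos
  · positivity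
  · exact le_rfl

end RankCrank

open RankCrank in
/-- For every negative integer `m` and every `n ≥ 1`, `M(≤ m, n) ≤ N(≤ m+1, n)`. -/
theorem Mle_le_Nle_succ (m : ℤ) (hm : m < 0) (n : ℕ) (hn : 1 ≤ n) :
    Mle m n ≤ Nle (m + 1) n := by
  obtain ⟨k, rfl⟩ : ∃ k : ℕ, m = -((k : ℤ) + 1) := ⟨(-m - 1).toNat, by omega⟩
  have hM : Mle (-((k : ℤ) + 1)) n ≤
      Nat.card {l : n.Partition // RankCrankSeries.SmallCrank k l.parts} := by
    refine (Finset.sum_le_sum fun r hr => M_le_card (by simp at hr; omega) n).trans ?_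
    rw [← Nat.cast_sum, sum_card_fiber, Nat.cast_le]
    exact Nat.card_mono (Set.toFinite _) fun l hl => smallCrank_of_crank_le hl.2
  have hN : Nat.card {l : n.Partition // ¬ RankCrankSeries.LargeRank k l.parts} ≤
      Nle (-((k : ℤ) + 1) + 1) n := by
    simp only [Nle, N]
    rw [← Nat.cast_sum, sum_card_fiber, Nat.cast_le]
    refine Nat.card_mono (Set.toFinite _) fun l hl => ⟨neg_le_rank l, ?_⟩
    have := rank_le_of_not_largeRank hn hl
    omega
  have h := RankCrankSeries.card_smallCrank_add_card_largeRank_le k n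
  have hc : Nat.card {l : n.Partition // RankCrankSeries.LargeRank k l.parts} +
      Nat.card {l : n.Partition // ¬ RankCrankSeries.LargeRank k l.parts} =
      Nat.card n.Partition := by
    classical
    rw [← Nat.card_sum]
    exact Nat.card_congr (Equiv.sumCompl _)
  omega
end
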